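/- arXiv:1310.3960 — 9 statements merged into one kernel-verified Lean document; each statement's English description precedes it below -/
import Mathlib

section
/- Let 0<q<1 and α > 0, and let w(x) = x^α (q²x²;q²)_∞. Let (P_n) be the monic polynomials orthogonal on the exponential lattice {qᵏ : k = 0,1,2,…}, i.e. ∑_{k=0}^∞ qᵏ P_n(qᵏ) P_m(qᵏ) w(qᵏ) = 0 for m ≠ n, with recurrence coefficients (a_n²), (b_n), and let μ_0 = ∑_{k=0}^∞ qᵏ w(qᵏ) and μ_1 = ∑_{k=0}^∞ q^{2k} w(qᵏ) be the first two moments. Define x_0 := q^{α/2} and x_n := q^{1−n−α/2} a_n² + q^{n+α/2} for n ≥ 1 (equivalently a_n² = q^{n+α/2−1}(x_n − q^{n+α/2}) for n ≥ 1). Then x_1 = q^{−α/2}(1 − μ₁²/μ₀²), b_0² = 1 − q^{α/2} x_1, for all n ≥ 1 the sequence satisfies the q-discrete Painlevé V equation in the form (x_n x_{n−1} − 1)(x_n x_{n+1} − 1)(x_n − q^{n+α/2})² = q^{2n+α} (x_n − q^{α/2})² (x_n − q^{−α/2})², and moreover b_n² x_n² q^{−2n−α} = 1 − x_n x_{n+1}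 − q^{−2n} (x_n x_{n−1} − 1)(x_n q^{−α/2} − qⁿ)² − 2 (x_n − q^{α/2})(x_n − q^{−α/2}) for n ≥ 1. -/
/-- The q-Pochhammer infinite product `(x;q)_∞ = ∏_{k=0}^∞ (1 - x qᵏ)`. -/
noncomputable def qPoch (x q : ℝ) : ℝ := ∏' k : ℕ, (1 - x * q ^ k)

/-- The q-Painlevé V equation and the formula for `b n`, from the two discrete equations. -/
theorem qPV_of_recurrences {q s : ℝ} (hq : q ≠ 0) (hs : s ≠ 0) {a b x σ : ℕ → ℝ}
    (ha : a 0 = 0)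
    (hσ0 : σ 0 = 0) (hσ : ∀ n, σ (n + 1) = σ n + b n)
    (hT : ∀ n, a (n + 1) + q * a n + (b n + (1 - q) * σ n) * b n
      = q ^ n * (1 + s ^ 2) - q ^ (2 * n) * s ^ 2 * (1 + q))
    (hR : ∀ n, a (n + 1) * (b (n + 1) + b n + (1 - q) * σ n)
      = q ^ (2 * n + 1) * s ^ 2 * (1 - q) * σ (n + 1))
    (hx : ∀ n, a n * q = q ^ n * s * (x n - q ^ n * s)) :
    s * x 1 = 1 - b 0 ^ 2 ∧
    ∀ n, (x (n + 1) * x n - 1) * (x (n + 1) * x (n + 2) - 1) * (x (n + 1) - q ^ (n + 1) * s) ^ 2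
        = q ^ (2 * (n + 1)) * s ^ 2 * (x (n + 1) - s) ^ 2 * (x (n + 1) - s⁻¹) ^ 2 ∧
      b (n + 1) ^ 2 * x (n + 1) ^ 2
        = q ^ (2 * (n + 1)) * s ^ 2 * (1 - x (n + 1) * x (n + 2))
          - s ^ 2 * (x (n + 1) * x n - 1) * (x (n + 1) * s⁻¹ - q ^ (n + 1)) ^ 2
          - 2 * (q ^ (2 * (n + 1)) * s ^ 2) * (x (n + 1) - s) * (x (n + 1) - s⁻¹) := by
  have hx0 : x 0 = s := by
    have := hx 0
    rw [ha] at this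
    have h2 : s * (x 0 - s) = 0 := by linear_combination -this
    rcases mul_eq_zero.1 h2 with h | h
    · exact absurd h hs
    · linarith
  obtain ⟨z, hz⟩ : ∃ z : ℕ → ℝ, ∀ n, z n = b n + (1 - q) * σ n := ⟨_, fun _ => rfl⟩
  have hqn : ∀ n, q ^ n ≠ 0 := fun n => pow_ne_zero n hq
  have T : ∀ n, q ^ n * s * (x (n + 1) + x n) + z n * b n = q ^ n * (1 + s ^ 2) := by
    intro n
    have h0 := hx n
    have h1 := hx (n + 1)
    have h2 := hT n
    have h1' : a (n + 1) = q ^ n * s * (x (n + 1) - q ^ (n + 1) * s) := by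
      apply mul_right_cancel₀ hq
      rw [h1]; ring
    rw [h1'] at h2
    rw [hz]
    rw [pow_mul'] at h2
    linear_combination h2 - h0
  have J : ∀ n, x (n + 1) * b (n + 1)
      = q ^ (n + 1) * s * z (n + 1) + (q ^ (n + 1) * s - x (n + 1)) * z n := by
    intro n
    have h1 := hx (n + 1)
    have h1' : a (n + 1) = q ^ n * s * (x (n + 1) - q ^ (n + 1) * s) := by
      apply mul_right_cancel₀ hq
      rw [h1]; ring
    have h2 := hR n
    rw [h1'] at h2
    have h3 : q ^ n * s ≠ 0 := mul_ne_zero (hqn n) hs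
    apply mul_left_cancel₀ h3
    rw [hz, hz]
    have : q ^ (2 * n + 1) = q ^ n * q ^ n * q := by ring
    rw [this] at h2
    rw [hσ] at h2 ⊢
    linear_combination h2
  have I : ∀ n, z (n + 1) - b (n + 1) = z n - q * b n := by
    intro n; rw [hz, hz, hσ]; ring
  have K : ∀ n, x (n + 1) * x n = 1 - z n ^ 2 := by
    intro n
    induction n with
    | zero =>
      have h := T 0
      have : z 0 = b 0 := by rw [hz, hσ0]; ring
      rw [hx0, this] at h
      rw [hx0, this]
      linear_combination h
    | succ n ih =>
      have h3 : q ^ (n + 1) * s ≠ 0 := mul_ne_zero (hqn _) hs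
      apply mul_left_cancel₀ h3
      have t0 := T n
      have t1 := T (n + 1)
      have j := J n
      have i := I n
      have hb : q * b n = z n - z (n + 1) + b (n + 1) := by linarith
      rw [pow_succ] at *
      linear_combination (x (n + 1)) * t1 - q * x (n + 1) * t0 + (z n - z (n + 1)) * j +
         (q ^ n * q * s) * ih + x (n + 1) * z n * hb
  have V : ∀ n, (q ^ (n + 1) * s - x (n + 1)) * z (n + 1) * z n
      = - q ^ (n + 1) * s * (x (n + 1) - s) * (x (n + 1) - s⁻¹) := by
    intro n
    have t1 := T (n + 1)
    have j := J n
    have k := K (n + 1)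
    have hss : s * s⁻¹ = 1 := mul_inv_cancel₀ hs
    linear_combination x (n + 1) * t1 - z (n + 1) * j - q ^ (n + 1) * s * k
      + q ^ (n + 1) * (-x (n + 1) + s) * hss
  refine ⟨?_, fun n => ⟨?_, ?_⟩⟩
  · have h := K 0
    have : z 0 = b 0 := by rw [hz, hσ0]; ring
    rw [hx0, this] at h
    linear_combination h
  · have k0 := K n
    have k1 := K (n + 1)
    have k1' : x (n + 1) * x (n + 2) = 1 - z (n + 1) ^ 2 := by rw [← k1]; ring
    rw [k0, k1']
    have v := congrArg (· ^ 2) (V n)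
    linear_combination v
  · have k0 := K n
    have k1 := K (n + 1)
    have k1' : x (n + 1) * x (n + 2) = 1 - z (n + 1) ^ 2 := by rw [← k1]; ring
    rw [k0, k1', ← mul_pow, mul_comm (b _), J]
    have v := V n
    have hss : s * s⁻¹ = 1 := mul_inv_cancel₀ hs
    have e : s ^ 2 * (x (n + 1) * s⁻¹ - q ^ (n + 1)) ^ 2 = (x (n + 1) - q ^ (n + 1) * s) ^ 2 := by
      rw [← mul_pow]; congr 1; linear_combination x (n + 1) * hss
    linear_combination 2 * (q ^ (n + 1) * s) * v + z n ^ 2 * (-e)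

section OrthogonalPolynomials

open Polynomial

variable {P : ℕ → ℝ[X]} {a b σ : ℕ → ℝ}

/-- Multiplication by `X` of the top three coefficients; the factor `X ^ 2` avoids truncated
subtraction of indices. -/
theorem coeff_X_sq_mul_recurrence
    (hrec : ∀ n, X * P n = P (n + 1) + C (b n) * P n + C (a n) * P (n - 1)) (n k : ℕ) :
    (X ^ 2 * P (n + 1)).coeff (k + 1)
      = (X ^ 2 * P n).coeff k - b n * (X ^ 2 * P n).coeff (k + 1)
        - a n * (X ^ 2 * P (n - 1)).coeff (k + 1) := by
  have h : X ^ 2 * P (n + 1) = X * (X ^ 2 * P n) - C (b n) * (X ^ 2 * P n)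
      - C (a n) * (X ^ 2 * P (n - 1)) := by
    linear_combination -X ^ 2 * hrec n
  rw [h, coeff_sub, coeff_sub, coeff_X_mul, coeff_C_mul, coeff_C_mul]

theorem coeff_X_sq_mul_eq_zero (hdeg : ∀ n, (P n).natDegree = n) {n k : ℕ} (hk : n + 2 < k) :
    (X ^ 2 * P n).coeff k = 0 := by
  obtain ⟨k, rfl⟩ : ∃ j, k = j + 2 := ⟨k - 2, by omega⟩
  rw [coeff_X_pow_mul]
  exact coeff_eq_zero_of_natDegree_lt (by rw [hdeg]; omega)

theorem coeff_X_sq_mul_leading (hmonic : ∀ n, (P n).Monic) (hdeg : ∀ n, (P n).natDegree = n)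
    (n : ℕ) : (X ^ 2 * P n).coeff (n + 2) = 1 := by
  rw [coeff_X_pow_mul]
  simpa [hdeg] using (hmonic n).coeff_natDegree

theorem coeff_X_sq_mul_subleading (hmonic : ∀ n, (P n).Monic) (hdeg : ∀ n, (P n).natDegree = n)
    (hrec : ∀ n, X * P n = P (n + 1) + C (b n) * P n + C (a n) * P (n - 1)) (ha : a 0 = 0)
    (hσ0 : σ 0 = 0) (hσ : ∀ n, σ (n + 1) = σ n + b n) (n : ℕ) :
    (X ^ 2 * P n).coeff (n + 1) = -σ n := by
  induction n with
  | zero => simp [hσ0, coeff_X_pow_mul']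
  | succ n ih =>
    rw [coeff_X_sq_mul_recurrence hrec, ih, coeff_X_sq_mul_leading hmonic hdeg, hσ]
    cases n with
    | zero => rw [ha]; ring
    | succ n =>
      rw [Nat.add_sub_cancel, coeff_X_sq_mul_eq_zero hdeg (by omega)]; ring

theorem coeff_X_sq_mul_subsubleading (hmonic : ∀ n, (P n).Monic)
    (hdeg : ∀ n, (P n).natDegree = n)
    (hrec : ∀ n, X * P n = P (n + 1) + C (b n) * P n + C (a n) * P (n - 1)) (ha : a 0 = 0)
    (hσ0 : σ 0 = 0) (hσ : ∀ n, σ (n + 1) = σ n + b n) (n : ℕ) :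
    (X ^ 2 * P (n + 1)).coeff (n + 1) = (X ^ 2 * P n).coeff n + b n * σ n - a n := by
  rw [coeff_X_sq_mul_recurrence hrec, coeff_X_sq_mul_subleading hmonic hdeg hrec ha hσ0 hσ]
  cases n with
  | zero => rw [ha]; ring
  | succ n =>
    rw [Nat.add_sub_cancel, coeff_X_sq_mul_leading hmonic hdeg]; ring

variable {L : ℝ[X] →ₗ[ℝ] ℝ}

theorem orthogonal_mul_of_degree_lt (hmonic : ∀ n, (P n).Monic)
    (hdeg : ∀ n, (P n).natDegree = n) (horth : ∀ m n, m ≠ n → L (P n * P m) = 0) (n : ℕ) :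
    ∀ d, ∀ f : ℝ[X], f.natDegree < d → d ≤ n → L (P n * f) = 0 := by
  intro d
  induction d with
  | zero => intro f hf; omega
  | succ d ih =>
    intro f hf hd
    have hg : f = (f - C (f.coeff d) * P d) + C (f.coeff d) * P d := by ring
    have hcoef : ∀ i, d ≤ i → (f - C (f.coeff d) * P d).coeff i = 0 := by
      intro i hi
      rw [coeff_sub, coeff_C_mul]
      rcases hi.eq_or_lt with rfl | hi
      · have := (hmonic d).coeff_natDegree
        rw [hdeg] at this
        rw [this]; ring
      · rw [coeff_eq_zero_of_natDegree_lt (p := f) (by omega),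
          coeff_eq_zero_of_natDegree_lt (p := P d) (by rw [hdeg]; omega)]; ring
    have hP : L (P n * (C (f.coeff d) * P d)) = 0 := by
      rw [mul_left_comm, ← smul_eq_C_mul, map_smul, horth d n (by omega), smul_zero]
    rw [hg, mul_add, map_add, hP, add_zero]
    rcases Nat.eq_zero_or_pos d with rfl | hd0
    · have : f - C (f.coeff 0) * P 0 = 0 := by
        ext i; exact hcoef i (Nat.zero_le _)
      rw [this, mul_zero, map_zero]
    · refine ih _ ?_ (by omega)
      by_contra! hcon
      have h0 : f - C (f.coeff d) * P d ≠ 0 := by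
        intro h0; rw [h0] at hcon; simp at hcon; omega
      exact h0 (leadingCoeff_eq_zero.1 (hcoef _ hcon))

theorem apply_mul_eq_sum {p f : ℝ[X]} {n : ℕ} (h : ∀ i < n, L (p * X ^ i) = 0)
    (hf : f.natDegree ≤ n + 2) :
    L (p * f) = f.coeff n * L (p * X ^ n) + f.coeff (n + 1) * L (p * X ^ (n + 1))
      + f.coeff (n + 2) * L (p * X ^ (n + 2)) := by
  conv_lhs => rw [f.as_sum_range' (n + 3) (by omega)]
  rw [Finset.mul_sum, map_sum]
  have e : ∀ i, L (p * monomial i (f.coeff i)) = f.coeff i * L (p * X ^ i) := by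
    intro i
    rw [← C_mul_X_pow_eq_monomial, mul_left_comm, ← smul_eq_C_mul, map_smul, smul_eq_mul]
  simp only [e]
  rw [Finset.sum_range_succ, Finset.sum_range_succ, Finset.sum_range_succ,
    Finset.sum_eq_zero, zero_add]
  intro i hi
  rw [h i (Finset.mem_range.1 hi), mul_zero]


theorem apply_mul_X_pow_eq_zero (hmonic : ∀ n, (P n).Monic)
    (hdeg : ∀ n, (P n).natDegree = n) (horth : ∀ m n, m ≠ n → L (P n * P m) = 0) {n i : ℕ}
    (hi : i < n) : L (P n * X ^ i) = 0 :=
  orthogonal_mul_of_degree_lt hmonic hdeg horth n (i + 1) _ (by simp) hi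

theorem apply_mul_X_pow_succ
    (hrec : ∀ n, X * P n = P (n + 1) + C (b n) * P n + C (a n) * P (n - 1)) (n k : ℕ) :
    L (P n * X ^ (k + 1)) = L (P (n + 1) * X ^ k) + b n * L (P n * X ^ k)
      + a n * L (P (n - 1) * X ^ k) := by
  have : P n * X ^ (k + 1) = P (n + 1) * X ^ k + C (b n) * (P n * X ^ k)
      + C (a n) * (P (n - 1) * X ^ k) := by
    linear_combination X ^ k * hrec n
  rw [this, map_add, map_add, ← smul_eq_C_mul, ← smul_eq_C_mul, map_smul, map_smul,
    smul_eq_mul, smul_eq_mul]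

theorem norm_sq_succ (hmonic : ∀ n, (P n).Monic)
    (hdeg : ∀ n, (P n).natDegree = n) (horth : ∀ m n, m ≠ n → L (P n * P m) = 0)
    (hrec : ∀ n, X * P n = P (n + 1) + C (b n) * P n + C (a n) * P (n - 1)) (n : ℕ) :
    L (P (n + 1) * X ^ (n + 1)) = a (n + 1) * L (P n * X ^ n) := by
  rw [apply_mul_X_pow_succ hrec, apply_mul_X_pow_eq_zero hmonic hdeg horth (by omega),
    apply_mul_X_pow_eq_zero hmonic hdeg horth (by omega)]
  simp

theorem apply_mul_X_pow_add_one (hmonic : ∀ n, (P n).Monic)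
    (hdeg : ∀ n, (P n).natDegree = n) (horth : ∀ m n, m ≠ n → L (P n * P m) = 0)
    (hrec : ∀ n, X * P n = P (n + 1) + C (b n) * P n + C (a n) * P (n - 1)) (ha : a 0 = 0)
    (hσ0 : σ 0 = 0) (hσ : ∀ n, σ (n + 1) = σ n + b n) (n : ℕ) :
    L (P n * X ^ (n + 1)) = σ (n + 1) * L (P n * X ^ n) := by
  induction n with
  | zero =>
    rw [apply_mul_X_pow_succ hrec, apply_mul_X_pow_eq_zero hmonic hdeg horth (by omega), ha,
      hσ, hσ0]
    ring
  | succ n ih =>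
    rw [apply_mul_X_pow_succ hrec, apply_mul_X_pow_eq_zero hmonic hdeg horth (by omega),
      Nat.add_sub_cancel, ih, hσ (n + 1), norm_sq_succ hmonic hdeg horth hrec]
    ring

theorem apply_mul_X_pow_add_two (hmonic : ∀ n, (P n).Monic)
    (hdeg : ∀ n, (P n).natDegree = n) (horth : ∀ m n, m ≠ n → L (P n * P m) = 0)
    (hrec : ∀ n, X * P n = P (n + 1) + C (b n) * P n + C (a n) * P (n - 1)) (ha : a 0 = 0)
    (hσ0 : σ 0 = 0) (hσ : ∀ n, σ (n + 1) = σ n + b n) (n : ℕ) :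
    L (P n * X ^ (n + 2)) = (σ (n + 1) ^ 2 + a (n + 1) + a n - (X ^ 2 * P n).coeff n - b n * σ n)
      * L (P n * X ^ n) := by
  induction n with
  | zero =>
    rw [apply_mul_X_pow_succ hrec, apply_mul_X_pow_add_one hmonic hdeg horth hrec ha hσ0 hσ,
      norm_sq_succ hmonic hdeg horth hrec, ha, hσ, hσ0]
    simp
    ring
  | succ n ih =>
    rw [apply_mul_X_pow_succ hrec, apply_mul_X_pow_add_one hmonic hdeg horth hrec ha hσ0 hσ,
      norm_sq_succ hmonic hdeg horth hrec (n + 1), Nat.add_sub_cancel, ih,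
      norm_sq_succ hmonic hdeg horth hrec n,
      coeff_X_sq_mul_subsubleading hmonic hdeg hrec ha hσ0 hσ, hσ (n + 1), hσ n]
    ring

variable {q A : ℝ}

theorem coeff_X_sq_mul_comp_inv (hq : q ≠ 0) (p : ℝ[X]) (n : ℕ) :
    (X ^ 2 * p.comp (C q⁻¹ * X)).coeff n = q ^ 2 * q⁻¹ ^ n * (X ^ 2 * p).coeff n := by
  have : X ^ 2 * p.comp (C q⁻¹ * X) = C (q ^ 2) * (X ^ 2 * p).comp (C q⁻¹ * X) := by
    have hqq : (C q * C q⁻¹ : ℝ[X]) = 1 := by rw [← C_mul, mul_inv_cancel₀ hq, C_1]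
    simp only [mul_comp, X_pow_comp, C_pow]
    linear_combination (-X ^ 2 * p.comp (C q⁻¹ * X)) * (C q * C q⁻¹ + 1) * hqq
  rw [this, coeff_C_mul, comp_C_mul_X_coeff]
  ring

theorem comp_inv_mul_X_comp (hq : q ≠ 0) (p : ℝ[X]) :
    (p.comp (C q⁻¹ * X)).comp (C q * X) = p := by
  rw [comp_assoc]; simp [← mul_assoc, ← C_mul, hq]

theorem natDegree_comp_C_mul_X_le (p : ℝ[X]) (r : ℝ) :
    (p.comp (C r * X)).natDegree ≤ p.natDegree := by
  refine natDegree_comp_le.trans ?_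
  have h : (C r * X).natDegree ≤ 1 := (natDegree_C_mul_le r X).trans natDegree_X_le
  simpa using Nat.mul_le_mul_left p.natDegree h

/-- The first discrete equation obtained from the Pearson equation of the functional. -/
theorem pearson_norm_equation (hq : q ≠ 0) (hmonic : ∀ n, (P n).Monic)
    (hdeg : ∀ n, (P n).natDegree = n) (horth : ∀ m n, m ≠ n → L (P n * P m) = 0)
    (hrec : ∀ n, X * P n = P (n + 1) + C (b n) * P n + C (a n) * P (n - 1)) (ha : a 0 = 0)
    (hσ0 : σ 0 = 0) (hσ : ∀ n, σ (n + 1) = σ n + b n)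
    (hL : ∀ p : ℝ[X], L ((1 - X ^ 2) * p) = A * L (p.comp (C q * X)))
    (hne : ∀ n, L (P n * X ^ n) ≠ 0) (n : ℕ) :
    1 - (σ (n + 1) ^ 2 + a (n + 1) + a n - (X ^ 2 * P n).coeff n - b n * σ n)
      + q * σ n * σ (n + 1) - q ^ 2 * (X ^ 2 * P n).coeff n = A * q ^ (2 * n) := by
  have key := hL (P n * (P n).comp (C q⁻¹ * X))
  rw [mul_comp, comp_inv_mul_X_comp hq, mul_comm ((P n).comp _) (P n),
    show (1 - X ^ 2) * (P n * (P n).comp (C q⁻¹ * X))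
      = P n * (P n).comp (C q⁻¹ * X) - P n * (X ^ 2 * (P n).comp (C q⁻¹ * X)) by ring,
    map_sub] at key
  have hz : ∀ i < n, L (P n * X ^ i) = 0 := fun i hi =>
    apply_mul_X_pow_eq_zero hmonic hdeg horth hi
  have hd : ∀ r : ℝ, ((P n).comp (C r * X)).natDegree ≤ n := fun r => by
    simpa [hdeg] using natDegree_comp_C_mul_X_le (P n) r
  have hd2 : (X ^ 2 * (P n).comp (C q⁻¹ * X)).natDegree ≤ n + 2 := by
    refine natDegree_mul_le.trans ?_
    have := hd q⁻¹
    rw [natDegree_X_pow]; omega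
  have hPn : (P n).coeff n = 1 := by
    have := (hmonic n).coeff_natDegree
    rwa [hdeg] at this
  have hP1 : (P n).coeff (n + 1) = 0 := coeff_eq_zero_of_natDegree_lt (by rw [hdeg]; omega)
  have hP2 : (P n).coeff (n + 2) = 0 := coeff_eq_zero_of_natDegree_lt (by rw [hdeg]; omega)
  rw [apply_mul_eq_sum (f := (P n).comp (C q⁻¹ * X)) hz (by have := hd q⁻¹; omega),
    apply_mul_eq_sum hz hd2,
    apply_mul_eq_sum (f := (P n).comp (C q * X)) hz (by have := hd q; omega)] at key
  simp only [comp_C_mul_X_coeff, hPn, hP1, hP2] at key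
  rw [apply_mul_X_pow_add_one hmonic hdeg horth hrec ha hσ0 hσ,
    apply_mul_X_pow_add_two hmonic hdeg horth hrec ha hσ0 hσ] at key
  have hqq : q * q⁻¹ = 1 := mul_inv_cancel₀ hq
  have hqqn : q ^ n * q⁻¹ ^ n = 1 := by rw [← mul_pow, hqq, one_pow]
  have e0 : (X ^ 2 * (P n).comp (C q⁻¹ * X)).coeff n
      = q⁻¹ ^ n * q ^ 2 * (X ^ 2 * P n).coeff n := by
    rw [coeff_X_sq_mul_comp_inv hq]; ring
  have e1 : (X ^ 2 * (P n).comp (C q⁻¹ * X)).coeff (n + 1) = - q⁻¹ ^ n * q * σ n := by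
    rw [coeff_X_sq_mul_comp_inv hq, coeff_X_sq_mul_subleading hmonic hdeg hrec ha hσ0 hσ]
    linear_combination -(q * q⁻¹ ^ n * σ n) * hqq
  have e2 : (X ^ 2 * (P n).comp (C q⁻¹ * X)).coeff (n + 2) = q⁻¹ ^ n := by
    rw [coeff_X_sq_mul_comp_inv hq, coeff_X_sq_mul_leading hmonic hdeg]
    linear_combination q⁻¹ ^ n * (q * q⁻¹ + 1) * hqq
  rw [e0, e1, e2] at key
  apply mul_right_cancel₀ (mul_ne_zero (inv_ne_zero (pow_ne_zero n hq)) (hne n))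
  rw [← inv_pow, pow_mul']
  linear_combination key + A * q ^ n * L (P n * X ^ n) * (-hqqn)

/-- The second discrete equation obtained from the Pearson equation of the functional. -/
theorem pearson_subleading_equation (hq : q ≠ 0) (hmonic : ∀ n, (P n).Monic)
    (hdeg : ∀ n, (P n).natDegree = n) (horth : ∀ m n, m ≠ n → L (P n * P m) = 0)
    (hrec : ∀ n, X * P n = P (n + 1) + C (b n) * P n + C (a n) * P (n - 1)) (ha : a 0 = 0)
    (hσ0 : σ 0 = 0) (hσ : ∀ n, σ (n + 1) = σ n + b n)
    (hL : ∀ p : ℝ[X], L ((1 - X ^ 2) * p) = A * L (p.comp (C q * X)))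
    (hne : ∀ n, L (P n * X ^ n) ≠ 0) (n : ℕ) :
    a (n + 1) * (σ (n + 2) - q * σ n) = A * q ^ (2 * n) * (1 - q) * σ (n + 1) := by
  have key := hL (P (n + 1) * (P n).comp (C q⁻¹ * X))
  rw [mul_comp, comp_inv_mul_X_comp hq, mul_comm ((P (n + 1)).comp _) (P n),
    show (1 - X ^ 2) * (P (n + 1) * (P n).comp (C q⁻¹ * X))
      = P (n + 1) * (P n).comp (C q⁻¹ * X)
        - P (n + 1) * (X ^ 2 * (P n).comp (C q⁻¹ * X)) by ring,
    map_sub] at key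
  have hz : ∀ m, ∀ i < m, L (P m * X ^ i) = 0 := fun m i hi =>
    apply_mul_X_pow_eq_zero hmonic hdeg horth hi
  have hd : ∀ (m : ℕ) (r : ℝ), ((P m).comp (C r * X)).natDegree ≤ m := fun m r => by
    simpa [hdeg] using natDegree_comp_C_mul_X_le (P m) r
  have hd2 : (X ^ 2 * (P n).comp (C q⁻¹ * X)).natDegree ≤ n + 2 := by
    refine natDegree_mul_le.trans ?_
    have := hd n q⁻¹
    rw [natDegree_X_pow]; omega
  have hP1 : (P (n + 1)).coeff (n + 1) = 1 := by
    have := (hmonic (n + 1)).coeff_natDegree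
    rwa [hdeg] at this
  have hP0 : (P (n + 1)).coeff n = -σ (n + 1) := by
    rw [← coeff_X_sq_mul_subleading hmonic hdeg hrec ha hσ0 hσ (n + 1), coeff_X_pow_mul]
  have hP2 : (P (n + 1)).coeff (n + 2) = 0 :=
    coeff_eq_zero_of_natDegree_lt (by rw [hdeg]; omega)
  rw [orthogonal_mul_of_degree_lt hmonic hdeg horth (n + 1) (n + 1) _
      (by have := hd n q⁻¹; omega) le_rfl,
    apply_mul_eq_sum (hz (n + 1)) (by omega),
    apply_mul_eq_sum (hz n) (by have := hd (n + 1) q; omega)] at key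
  simp only [comp_C_mul_X_coeff, hP0, hP1, hP2] at key
  have c3 : (X ^ 2 * (P n).comp (C q⁻¹ * X)).coeff (n + 1 + 2) = 0 :=
    coeff_eq_zero_of_natDegree_lt (by omega)
  rw [c3, apply_mul_X_pow_add_one hmonic hdeg horth hrec ha hσ0 hσ,
    apply_mul_X_pow_add_one hmonic hdeg horth hrec ha hσ0 hσ,
    norm_sq_succ hmonic hdeg horth hrec] at key
  have hqq : q * q⁻¹ = 1 := mul_inv_cancel₀ hq
  have hqqn : q ^ n * q⁻¹ ^ n = 1 := by rw [← mul_pow, hqq, one_pow]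
  have e1 : (X ^ 2 * (P n).comp (C q⁻¹ * X)).coeff (n + 1) = - q⁻¹ ^ n * q * σ n := by
    rw [coeff_X_sq_mul_comp_inv hq, coeff_X_sq_mul_subleading hmonic hdeg hrec ha hσ0 hσ]
    linear_combination -(q * q⁻¹ ^ n * σ n) * hqq
  have e2 : (X ^ 2 * (P n).comp (C q⁻¹ * X)).coeff (n + 1 + 1) = q⁻¹ ^ n := by
    rw [coeff_X_sq_mul_comp_inv hq, coeff_X_sq_mul_leading hmonic hdeg]
    linear_combination q⁻¹ ^ n * (q * q⁻¹ + 1) * hqq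
  rw [e1, e2] at key
  apply mul_right_cancel₀ (mul_ne_zero (inv_ne_zero (pow_ne_zero n hq)) (hne n))
  rw [← inv_pow, pow_mul']
  linear_combination -key
    + A * q ^ n * (1 - q) * σ (n + 1) * L (P n * X ^ n) * (-hqqn)

/-- The integrated form of `pearson_norm_equation`. -/
theorem pearson_norm_equation_integrated {s : ℝ} (hq : q ≠ 0)
    (hA : A = q * s ^ 2) (hmonic : ∀ n, (P n).Monic)
    (hdeg : ∀ n, (P n).natDegree = n) (horth : ∀ m n, m ≠ n → L (P n * P m) = 0)
    (hrec : ∀ n, X * P n = P (n + 1) + C (b n) * P n + C (a n) * P (n - 1)) (ha : a 0 = 0)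
    (hσ0 : σ 0 = 0) (hσ : ∀ n, σ (n + 1) = σ n + b n)
    (hL : ∀ p : ℝ[X], L ((1 - X ^ 2) * p) = A * L (p.comp (C q * X)))
    (hne : ∀ n, L (P n * X ^ n) ≠ 0) (n : ℕ) :
    a (n + 1) + q * a n + (b n + (1 - q) * σ n) * b n
      = q ^ n * (1 + s ^ 2) - q ^ (2 * n) * s ^ 2 * (1 + q) := by
  have E := pearson_norm_equation hq hmonic hdeg horth hrec ha hσ0 hσ hL hne
  have S : ∀ n, (1 - q ^ 2) * (X ^ 2 * P n).coeff n
      = (1 - q) * (σ n ^ 2 + a n) - (1 - q ^ n) * (1 - q ^ n * s ^ 2) := by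
    intro n
    induction n with
    | zero => simp [ha, hσ0]
    | succ n ih =>
      have e := E n
      rw [hσ, hA, pow_mul'] at e
      rw [coeff_X_sq_mul_subsubleading hmonic hdeg hrec ha hσ0 hσ, hσ, pow_succ]
      linear_combination (1 - (1 - q)) * ih + (1 - q) * e
  have e := E n
  rw [hσ, hA, pow_mul'] at e
  rw [pow_mul']
  linear_combination S n - e

end OrthogonalPolynomials

theorem summable_geometric_mul {q : ℝ} (hq0 : 0 < q) (hq1 : q < 1) (x : ℝ) :
    Summable fun k : ℕ => -(x * q ^ k) :=
  ((summable_geometric_of_lt_one hq0.le hq1).mul_left x).neg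

theorem qPoch_eq_mul {q : ℝ} (hq0 : 0 < q) (hq1 : q < 1) (x : ℝ) :
    qPoch x q = (1 - x) * qPoch (x * q) q := by
  unfold qPoch
  rw [tprod_eq_zero_mul']
  · simp [pow_succ', mul_assoc]
  · simpa [pow_succ', mul_assoc, sub_eq_add_neg] using
      Real.multipliable_one_add_of_summable (summable_geometric_mul hq0 hq1 (x * q))

theorem qPoch_mem_Ioc {q x : ℝ} (hq0 : 0 < q) (hq1 : q < 1) (hx0 : 0 ≤ x) (hx1 : x < 1) :
    qPoch x q ∈ Set.Ioc 0 1 := by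
  have hk : ∀ k : ℕ, 0 ≤ x * q ^ k ∧ x * q ^ k < 1 := fun k =>
    ⟨by positivity, (mul_le_of_le_one_right hx0 (pow_le_one₀ hq0.le hq1.le)).trans_lt hx1⟩
  have hlog := Real.summable_log_one_add_of_summable (summable_geometric_mul hq0 hq1 x)
  simp only [← sub_eq_add_neg] at hlog
  have h := Real.rexp_tsum_eq_tprod (fun k => sub_pos.2 (hk k).2) hlog
  unfold qPoch
  rw [← h]
  refine ⟨Real.exp_pos _, Real.exp_le_one_iff.2 (tsum_nonpos fun k => ?_)⟩
  exact Real.log_nonpos (sub_pos.2 (hk k).2).le (by linarith [(hk k).1])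

/-- The linear functional of a summable nonnegative mass distribution on the exponential
lattice. -/
theorem exists_lattice_functional {q : ℝ} (hq0 : 0 < q) (hq1 : q < 1) {v : ℕ → ℝ}
    (hv : Summable v) (hv0 : ∀ k, 0 ≤ v k) :
    ∃ L : Polynomial ℝ →ₗ[ℝ] ℝ, ∀ p, HasSum (fun k => p.eval (q ^ k) * v k) (L p) := by
  have hs : ∀ p : Polynomial ℝ, Summable fun k => p.eval (q ^ k) * v k := by
    intro p
    induction p using Polynomial.induction_on' with
    | add p r hp hr => simpa [add_mul] using hp.add hr
    | monomial n c =>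
      simp only [Polynomial.eval_monomial, mul_assoc]
      refine Summable.mul_left c (hv.of_nonneg_of_le (fun k => ?_) fun k => ?_)
      · have := hv0 k
        positivity
      · exact mul_le_of_le_one_left (hv0 k)
          (pow_le_one₀ (by positivity) (pow_le_one₀ hq0.le hq1.le))
  refine ⟨{ toFun := fun p => ∑' k, p.eval (q ^ k) * v k
            map_add' := fun p r => ?_
            map_smul' := fun c p => ?_ }, fun p => (hs p).hasSum⟩
  · simp only [Polynomial.eval_add, add_mul]
    exact (hs p).tsum_add (hs r)
  · simp only [Polynomial.eval_smul, smul_eq_mul, mul_assoc, RingHom.id_apply]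
    exact tsum_mul_left

open Polynomial in
theorem pearson_of_lattice_recurrence {q A : ℝ} {v : ℕ → ℝ}
    (hv : ∀ k, (1 - (q ^ (k + 1)) ^ 2) * v (k + 1) = A * v k)
    {L : ℝ[X] →ₗ[ℝ] ℝ} (hL : ∀ p, HasSum (fun k => p.eval (q ^ k) * v k) (L p)) (p : ℝ[X]) :
    L ((1 - X ^ 2) * p) = A * L (p.comp (C q * X)) := by
  rw [← (hL _).tsum_eq, ← (hL (p.comp _)).tsum_eq, (hL _).summable.tsum_eq_zero_add,
    ← tsum_mul_left]
  simp only [eval_mul, eval_sub, eval_one, eval_pow, eval_X, eval_comp, eval_C, pow_zero,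
    one_pow, sub_self, zero_mul, zero_add]
  refine tsum_congr fun k => ?_
  rw [← pow_succ']
  linear_combination p.eval (q ^ (k + 1)) * hv k

/-- Theorem 3: recurrence coefficients for the semiclassical little q-Laguerre weight
on the exponential lattice are expressed via a solution of q-Painlevé V. -/
theorem semiclassical_little_qLaguerre_qPV
    (q α : ℝ) (hq0 : 0 < q) (hq1 : q < 1) (hα : 0 < α)
    (w : ℝ → ℝ)
    (hw : ∀ x : ℝ, 0 < x → w x = x ^ α * qPoch (q ^ 2 * x ^ 2) (q ^ 2))
    (P : ℕ → Polynomial ℝ)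
    (hmonic : ∀ n, (P n).Monic)
    (hdeg : ∀ n, (P n).natDegree = n)
    (horth : ∀ m n : ℕ, m ≠ n →
      ∑' k : ℕ, q ^ k * (P n).eval (q ^ k) * (P m).eval (q ^ k) * w (q ^ k) = 0)
    (b a2 : ℕ → ℝ)
    (ha0 : a2 0 = 0) (hapos : ∀ n : ℕ, 1 ≤ n → 0 < a2 n)
    (hrec : ∀ n : ℕ, ∀ x : ℝ,
      x * (P n).eval x
        = (P (n + 1)).eval x + b n * (P n).eval x + a2 n * (P (n - 1)).eval x)
    (μ0 μ1 : ℝ)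
    (hμ0 : μ0 = ∑' k : ℕ, q ^ k * w (q ^ k))
    (hμ1 : μ1 = ∑' k : ℕ, q ^ (2 * k) * w (q ^ k))
    (x : ℕ → ℝ)
    (hx0 : x 0 = q ^ (α / 2))
    (hxn : ∀ n : ℕ, 1 ≤ n →
      x n = q ^ (1 - (n : ℝ) - α / 2) * a2 n + q ^ ((n : ℝ) + α / 2)) :
    x 1 = q ^ (-(α / 2)) * (1 - μ1 ^ 2 / μ0 ^ 2) ∧
    (b 0) ^ 2 = 1 - q ^ (α / 2) * x 1 ∧
    (∀ n : ℕ, 1 ≤ n →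
      (x n * x (n - 1) - 1) * (x n * x (n + 1) - 1) * (x n - q ^ ((n : ℝ) + α / 2)) ^ 2
        = q ^ (2 * (n : ℝ) + α) * (x n - q ^ (α / 2)) ^ 2 * (x n - q ^ (-(α / 2))) ^ 2) ∧
    (∀ n : ℕ, 1 ≤ n →
      (b n) ^ 2 * (x n) ^ 2 * q ^ (-2 * (n : ℝ) - α)
        = 1 - x n * x (n + 1)
          - q ^ (-2 * (n : ℝ)) * (x n * x (n - 1) - 1) * (x n * q ^ (-(α / 2)) - q ^ (n : ℝ)) ^ 2
          - 2 * (x n - q ^ (α / 2)) * (x n - q ^ (-(α / 2)))) := by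
  have hq2 : q ^ 2 < 1 := pow_lt_one₀ hq0.le hq1 two_ne_zero
  have hq20 : 0 < q ^ 2 := by positivity
  have hqk : ∀ k : ℕ, 0 < q ^ k ∧ q ^ k ≤ 1 := fun k =>
    ⟨by positivity, pow_le_one₀ hq0.le hq1.le⟩
  have hwk : ∀ k : ℕ, 0 < w (q ^ k) ∧ w (q ^ k) ≤ 1 := by
    intro k
    obtain ⟨h0, h1⟩ := hqk k
    have hlt : q ^ 2 * (q ^ k) ^ 2 < 1 :=
      (mul_le_of_le_one_right hq20.le (pow_le_one₀ h0.le h1)).trans_lt hq2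
    obtain ⟨p0, p1⟩ := qPoch_mem_Ioc hq20 hq2 (by positivity) hlt
    rw [hw _ h0]
    exact ⟨mul_pos (Real.rpow_pos_of_pos h0 α) p0,
      mul_le_one₀ (Real.rpow_le_one h0.le h1 hα.le) p0.le p1⟩
  obtain ⟨v, hv⟩ : ∃ v : ℕ → ℝ, ∀ k, v k = q ^ k * w (q ^ k) := ⟨_, fun _ => rfl⟩
  have hvpos : ∀ k, 0 < v k := fun k => by
    rw [hv]; exact mul_pos (hqk k).1 (hwk k).1
  have hvsum : Summable v := by
    refine (summable_geometric_of_lt_one hq0.le hq1).of_nonneg_of_le (fun k => (hvpos k).le)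
      fun k => ?_
    rw [hv]; exact mul_le_of_le_one_right (hqk k).1.le (hwk k).2
  obtain ⟨L, hL⟩ := exists_lattice_functional hq0 hq1 hvsum fun k => (hvpos k).le
  obtain ⟨s, hs⟩ : ∃ s, s = q ^ (α / 2) := ⟨_, rfl⟩
  have hs0 : 0 < s := hs ▸ Real.rpow_pos_of_pos hq0 _
  have hs2 : q ^ α = s ^ 2 := by
    rw [hs, ← Real.rpow_natCast, ← Real.rpow_mul hq0.le]; norm_num
  have hsinv : q ^ (-(α / 2)) = s⁻¹ := by rw [hs, Real.rpow_neg hq0.le]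
  have hvrec : ∀ k, (1 - (q ^ (k + 1)) ^ 2) * v (k + 1) = q * s ^ 2 * v k := by
    intro k
    have e : q ^ 2 * (q ^ k) ^ 2 = (q ^ (k + 1)) ^ 2 := by ring
    have e' : (q ^ (k + 1)) ^ 2 * q ^ 2 = q ^ 2 * (q ^ (k + 1)) ^ 2 := by ring
    rw [hv, hv, hw _ (hqk _).1, hw _ (hqk _).1, qPoch_eq_mul hq20 hq2 (q ^ 2 * (q ^ k) ^ 2), e,
      e', pow_succ q k, Real.mul_rpow (hqk k).1.le hq0.le, hs2]
    ring
  have hpear := pearson_of_lattice_recurrence hvrec hL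
  have hrec' : ∀ n, Polynomial.X * P n
      = P (n + 1) + Polynomial.C (b n) * P n + Polynomial.C (a2 n) * P (n - 1) := by
    intro n
    refine Polynomial.funext fun y => ?_
    simpa using hrec n y
  have horth' : ∀ m n, m ≠ n → L (P n * P m) = 0 := by
    intro m n hmn
    rw [← (hL _).tsum_eq, ← horth m n hmn]
    refine tsum_congr fun k => ?_
    rw [hv, Polynomial.eval_mul]; ring
  obtain ⟨σ, hσ0, hσ⟩ : ∃ σ : ℕ → ℝ, σ 0 = 0 ∧ ∀ n, σ (n + 1) = σ n + b n :=
    ⟨fun n => ∑ i ∈ Finset.range n, b i, by simp, fun n => Finset.sum_range_succ b n⟩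
  have hP0 : P 0 = 1 := (hmonic 0).natDegree_eq_zero.1 (hdeg 0)
  have hLμ0 : L 1 = μ0 := by
    rw [← (hL _).tsum_eq, hμ0]
    exact tsum_congr fun k => by rw [hv]; simp
  have hLμ1 : L Polynomial.X = μ1 := by
    rw [← (hL _).tsum_eq, hμ1]
    exact tsum_congr fun k => by rw [hv, Polynomial.eval_X]; ring
  have hμpos : μ0 ≠ 0 := by
    rw [hμ0]
    have := hvsum.tsum_pos (fun k => (hvpos k).le) 0 (hvpos 0)
    simp only [hv] at this
    exact this.ne'
  have hne : ∀ n, L (P n * Polynomial.X ^ n) ≠ 0 := by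
    intro n
    induction n with
    | zero => rwa [hP0, pow_zero, mul_one, hLμ0]
    | succ n ih =>
      rw [norm_sq_succ hmonic hdeg horth' hrec']
      exact mul_ne_zero (hapos _ (by omega)).ne' ih
  have hb0 : b 0 = μ1 / μ0 := by
    have := apply_mul_X_pow_add_one hmonic hdeg horth' hrec' ha0 hσ0 hσ 0
    rw [hP0, hσ, hσ0] at this
    simp only [zero_add, pow_one, one_mul, pow_zero, hLμ0, hLμ1] at this
    rw [eq_div_iff hμpos, this]
  have hT := pearson_norm_equation_integrated hq0.ne' rfl hmonic hdeg horth' hrec' ha0 hσ0 hσ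
    hpear hne
  have hR : ∀ n, a2 (n + 1) * (b (n + 1) + b n + (1 - q) * σ n)
      = q ^ (2 * n + 1) * s ^ 2 * (1 - q) * σ (n + 1) := by
    intro n
    have := pearson_subleading_equation hq0.ne' hmonic hdeg horth' hrec' ha0 hσ0 hσ hpear hne n
    rw [hσ (n + 1), hσ n] at this
    rw [hσ n]
    linear_combination this
  have hpow : ∀ n : ℕ, q ^ ((n : ℝ) + α / 2) = q ^ n * s := fun n => by
    rw [Real.rpow_add hq0, Real.rpow_natCast, hs]
  have hpow2 : ∀ n : ℕ, q ^ (2 * (n : ℝ) + α) = q ^ (2 * n) * s ^ 2 := fun n => by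
    rw [Real.rpow_add hq0, hs2, ← Real.rpow_natCast q (2 * n)]; push_cast; rfl
  have hx : ∀ n, a2 n * q = q ^ n * s * (x n - q ^ n * s) := by
    intro n
    rcases Nat.eq_zero_or_pos n with rfl | hn
    · rw [hx0, ha0, ← hs]; ring
    · have : q ^ (1 - (n : ℝ) - α / 2) = q * (q ^ n * s)⁻¹ := by
        rw [← hpow, ← Real.rpow_neg hq0.le, sub_sub, sub_eq_add_neg, Real.rpow_add hq0,
          Real.rpow_one]
      rw [hxn n hn, this, hpow]
      have := (hqk n).1.ne'
      field_simp
      ring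
  obtain ⟨h1, h2⟩ := qPV_of_recurrences hq0.ne' hs0.ne' ha0 hσ0 hσ hT hR hx
  refine ⟨?_, ?_, ?_, ?_⟩
  · rw [hsinv, ← div_pow, ← hb0, ← h1, inv_mul_cancel_left₀ hs0.ne']
  · rw [← hs, h1]; ring
  · rintro (_ | n) hn
    · omega
    · rw [hpow, hpow2, hsinv, ← hs, Nat.add_sub_cancel]
      exact (h2 n).1
  · rintro (_ | n) hn
    · omega
    · have e1 : q ^ (-2 * ((n + 1 : ℕ) : ℝ) - α) = (q ^ (2 * (n + 1)) * s ^ 2)⁻¹ := by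
        rw [← hpow2, ← Real.rpow_neg hq0.le]; congr 1; ring
      have e2 : q ^ (-2 * ((n + 1 : ℕ) : ℝ)) = (q ^ (2 * (n + 1)))⁻¹ := by
        rw [← Real.rpow_natCast, ← Real.rpow_neg hq0.le]; congr 1; push_cast; ring
      rw [e1, e2, hsinv, ← hs, Nat.add_sub_cancel, Real.rpow_natCast, (h2 n).2]
      have := (hqk (2 * (n + 1))).1.ne'
      have := hs0.ne'
      generalize q ^ (2 * (n + 1)) = Q at *
      generalize x (n + 1) * s⁻¹ - q ^ (n + 1) = y
      generalize x (n + 1) - s⁻¹ = y'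
      field_simp
end

section
/- Let k > 0, q = exp(−1/(2k²)), and let μ_n = ∫₀^∞ xⁿ (k/√π) exp(−k²(log x)²) dx and m_n = ∫₀^∞ xⁿ · x^{1/2}/((−x;q)_∞ (−q/x;q)_∞) dx. Then for every nonnegative integer n, μ_n/μ_0 = q^{−n²/2 − n} = m_n/m_0. In particular, Askey's weight with α = 1/2 has the same normalized moment sequence as the Stieltjes–Wigert weight, so the monic orthogonal polynomials for the two weights coincide. -/
open MeasureTheory Set

open Polynomial in
theorem Polynomial.functional_mul_eq_zero_of_degree_lt {R : Type*} [CommRing R]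
    (L : R[X] →ₗ[R] R) (P : ℕ → R[X]) (hP : ∀ n, (P n).Monic)
    (hdeg : ∀ n, (P n).natDegree = n) (horth : ∀ i j, i ≠ j → L (P i * P j) = 0)
    (n d : ℕ) (hd : d ≤ n) (p : R[X]) (hp : p.degree < d) : L (P n * p) = 0 := by
  induction d generalizing p with
  | zero =>
    have : p = 0 := by simpa using hp
    simp [this]
  | succ d ih =>
    have hlt : (p - C (p.coeff d) * P d).degree < d := by
      rw [degree_lt_iff_coeff_zero]
      intro m hm
      rcases hm.eq_or_lt with rfl | hm
      · have h1 : (P d).coeff d = 1 := by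
          simpa [Monic, leadingCoeff, hdeg] using hP d
        simp [h1]
      · have h1 : p.coeff m = 0 := (degree_lt_iff_coeff_zero _ _).1 hp m hm
        have h2 : (P d).coeff m = 0 := coeff_eq_zero_of_natDegree_lt (by rw [hdeg]; exact hm)
        simp [h1, h2]
    have hsplit : P n * p = P n * (p - C (p.coeff d) * P d) + p.coeff d • (P n * P d) := by
      rw [smul_eq_C_mul]; ring
    rw [hsplit, map_add, map_smul, ih (by omega) _ hlt, horth n d (by omega)]
    simp

open Polynomial in
/-- Monic orthogonal polynomials for a definite functional are unique. -/
theorem Polynomial.monic_orthogonal_unique {R : Type*} [CommRing R]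
    (L : R[X] →ₗ[R] R) (hL : ∀ p, L (p * p) = 0 → p = 0) (P Q : ℕ → R[X])
    (hP : ∀ n, (P n).Monic) (hPdeg : ∀ n, (P n).natDegree = n)
    (hPorth : ∀ i j, i ≠ j → L (P i * P j) = 0)
    (hQ : ∀ n, (Q n).Monic) (hQdeg : ∀ n, (Q n).natDegree = n)
    (hQorth : ∀ i j, i ≠ j → L (Q i * Q j) = 0) : P = Q := by
  funext n
  have hlt : (P n - Q n).degree < n := by
    rw [degree_lt_iff_coeff_zero]
    intro m hm
    rcases hm.eq_or_lt with rfl | hm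
    · have h1 : (P n).coeff n = 1 := by
        simpa [Monic, leadingCoeff, hPdeg] using hP n
      have h2 : (Q n).coeff n = 1 := by
        simpa [Monic, leadingCoeff, hQdeg] using hQ n
      simp [h1, h2]
    · rw [coeff_sub, coeff_eq_zero_of_natDegree_lt (by rw [hPdeg]; exact hm),
        coeff_eq_zero_of_natDegree_lt (by rw [hQdeg]; exact hm), sub_zero]
  have h1 := functional_mul_eq_zero_of_degree_lt L P hP hPdeg hPorth n n le_rfl _ hlt
  have h2 := functional_mul_eq_zero_of_degree_lt L Q hQ hQdeg hQorth n n le_rfl _ hlt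
  refine sub_eq_zero.1 (hL _ ?_)
  rw [sub_mul, map_sub, h1, h2, sub_zero]

theorem integrable_polynomial_mul {ν : Measure ℝ} {w : ℝ → ℝ}
    (hw : ∀ n : ℕ, Integrable (fun x => x ^ n * w x) ν) (p : Polynomial ℝ) :
    Integrable (fun x => p.eval x * w x) ν := by
  induction p using Polynomial.induction_on' with
  | add p r hp hr =>
    simp only [Polynomial.eval_add, add_mul]
    exact hp.add hr
  | monomial n a => simpa [mul_assoc] using (hw n).const_mul a

/-- Integration of polynomials against a weight with finite moments. -/
noncomputable def momentFunctional (ν : Measure ℝ) (w : ℝ → ℝ)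
    (hw : ∀ n : ℕ, Integrable (fun x => x ^ n * w x) ν) : Polynomial ℝ →ₗ[ℝ] ℝ where
  toFun p := ∫ x, p.eval x * w x ∂ν
  map_add' p r := by
    simp only [Polynomial.eval_add, add_mul]
    exact integral_add (integrable_polynomial_mul hw p) (integrable_polynomial_mul hw r)
  map_smul' a p := by
    simp only [Polynomial.eval_smul, smul_eq_mul, mul_assoc, RingHom.id_apply]
    exact integral_const_mul _ _

theorem eq_zero_of_integral_sq_mul_eq_zero {w : ℝ → ℝ} (hpos : ∀ x, 0 < x → 0 < w x)
    (hw : ∀ n : ℕ, IntegrableOn (fun x => x ^ n * w x) (Ioi 0)) (p : Polynomial ℝ)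
    (hp : ∫ x in Ioi (0 : ℝ), (p * p).eval x * w x = 0) : p = 0 := by
  by_contra hne
  have hnn : 0 ≤ᵐ[volume.restrict (Ioi 0)] fun x => (p * p).eval x * w x := by
    filter_upwards [ae_restrict_mem measurableSet_Ioi] with x hx
    simp only [Polynomial.eval_mul, Pi.zero_apply]
    exact mul_nonneg (mul_self_nonneg _) (hpos x hx).le
  have h0 := (integral_eq_zero_iff_of_nonneg_ae hnn (integrable_polynomial_mul hw (p * p))).1 hp
  have hroots : ∀ᵐ x ∂(volume.restrict (Ioi (0 : ℝ))), x ∉ p.rootSet ℝ :=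
    ae_restrict_of_ae ((p.rootSet_finite ℝ).countable.ae_notMem _)
  have hfalse : ∀ᵐ _ ∂(volume.restrict (Ioi (0 : ℝ))), False := by
    filter_upwards [h0, hroots, ae_restrict_mem measurableSet_Ioi] with x h1 h2 hx
    have : p.eval x = 0 := by simpa [(hpos x hx).ne'] using h1
    exact h2 (by simp [Polynomial.mem_rootSet, hne, this])
  rw [Filter.eventually_false_iff_eq_bot, ae_eq_bot] at hfalse
  simpa using congrArg (fun ν => ν univ) hfalse

theorem momentFunctional_eq_const_mul {ν : Measure ℝ} {v w : ℝ → ℝ} {c : ℝ}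
    (hv : ∀ n : ℕ, Integrable (fun x => x ^ n * v x) ν)
    (hw : ∀ n : ℕ, Integrable (fun x => x ^ n * w x) ν)
    (h : ∀ n : ℕ, ∫ x, x ^ n * v x ∂ν = c * ∫ x, x ^ n * w x ∂ν) (p : Polynomial ℝ) :
    momentFunctional ν v hv p = c * momentFunctional ν w hw p := by
  induction p using Polynomial.induction_on' with
  | add p r hp hr => rw [map_add, map_add, hp, hr, mul_add]
  | monomial n a =>
    simp only [momentFunctional, LinearMap.coe_mk, AddHom.coe_mk, Polynomial.eval_monomial,
      mul_assoc, integral_const_mul, h]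
    ring

section StieltjesWigert

theorem integrableOn_Ioi_iff_exp (f : ℝ → ℝ) :
    IntegrableOn f (Ioi 0) ↔ Integrable fun t => Real.exp t * f (Real.exp t) := by
  have := integrableOn_image_iff_integrableOn_abs_deriv_smul (s := univ) MeasurableSet.univ
    (fun x _ => (Real.hasDerivAt_exp x).hasDerivWithinAt) Real.exp_injective.injOn f
  simpa [Real.range_exp] using this

theorem integral_Ioi_eq_exp (f : ℝ → ℝ) :
    ∫ x in Ioi 0, f x = ∫ t, Real.exp t * f (Real.exp t) := by
  have := integral_image_eq_integral_abs_deriv_smul (s := univ) MeasurableSet.univ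
    (fun x _ => (Real.hasDerivAt_exp x).hasDerivWithinAt) Real.exp_injective.injOn f
  simpa [Real.range_exp] using this

variable {k : ℝ}

theorem exp_mul_stieltjesWigert (hk : 0 < k) (n : ℕ) (t : ℝ) :
    Real.exp t * (Real.exp t ^ n *
      (k / Real.sqrt Real.pi * Real.exp (-k ^ 2 * Real.log (Real.exp t) ^ 2))) =
    k / Real.sqrt Real.pi * Real.exp (((n : ℝ) + 1) ^ 2 / (4 * k ^ 2)) *
      Real.exp (-k ^ 2 * (t - ((n : ℝ) + 1) / (2 * k ^ 2)) ^ 2) := by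
  have : t + n * t + -k ^ 2 * t ^ 2 = ((n : ℝ) + 1) ^ 2 / (4 * k ^ 2) +
      -k ^ 2 * (t - ((n : ℝ) + 1) / (2 * k ^ 2)) ^ 2 := by
    field_simp
    ring
  rw [Real.log_exp, ← Real.exp_nat_mul, mul_assoc (k / _), ← Real.exp_add, ← this,
    Real.exp_add, Real.exp_add]
  ring

theorem integrableOn_pow_mul_stieltjesWigert (hk : 0 < k) (n : ℕ) :
    IntegrableOn (fun x : ℝ => x ^ n *
      (k / Real.sqrt Real.pi * Real.exp (-k ^ 2 * Real.log x ^ 2))) (Ioi 0) := by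
  rw [integrableOn_Ioi_iff_exp]
  simp only [exp_mul_stieltjesWigert hk]
  exact ((integrable_exp_neg_mul_sq (by positivity : 0 < k ^ 2)).comp_sub_right _).const_mul _

theorem integral_pow_mul_stieltjesWigert (hk : 0 < k) (n : ℕ) :
    ∫ x in Ioi (0 : ℝ), x ^ n *
      (k / Real.sqrt Real.pi * Real.exp (-k ^ 2 * Real.log x ^ 2)) =
    Real.exp (((n : ℝ) + 1) ^ 2 / (4 * k ^ 2)) := by
  rw [integral_Ioi_eq_exp]
  simp only [exp_mul_stieltjesWigert hk]
  rw [integral_const_mul, integral_sub_right_eq_self (fun t => Real.exp (-k ^ 2 * t ^ 2)),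
    integral_gaussian, Real.sqrt_div Real.pi_pos.le, Real.sqrt_sq hk.le]
  have := Real.sqrt_pos.2 Real.pi_pos
  field_simp

end StieltjesWigert

section QPoch

variable {q : ℝ}

theorem multipliable_qPoch (hq0 : 0 < q) (hq1 : q < 1) (x : ℝ) :
    Multipliable fun k : ℕ => 1 - x * q ^ k := by
  have : Summable fun k : ℕ => -x * q ^ k :=
    (summable_geometric_of_lt_one hq0.le hq1).mul_left _
  simpa [sub_eq_add_neg] using Real.multipliable_one_add_of_summable this

theorem qPoch_eq_one_sub_mul (hq0 : 0 < q) (hq1 : q < 1) (x : ℝ) :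
    qPoch x q = (1 - x) * qPoch (x * q) q := by
  unfold qPoch
  have h : (fun k : ℕ => 1 - x * q ^ (k + 1)) = fun k : ℕ => 1 - x * q * q ^ k := by
    funext k; ring
  rw [tprod_eq_zero_mul' (h ▸ multipliable_qPoch hq0 hq1 (x * q)), h]
  simp

theorem prod_range_le_qPoch_neg (hq0 : 0 < q) (hq1 : q < 1) {x : ℝ} (hx : 0 ≤ x) (N : ℕ) :
    ∏ k ∈ Finset.range N, (1 + x * q ^ k) ≤ qPoch (-x) q := by
  have hm := (multipliable_qPoch hq0 hq1 (-x)).hasProd.tendsto_prod_nat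
  have hmono : Monotone fun N => ∏ k ∈ Finset.range N, (1 - -x * q ^ k) := by
    refine monotone_nat_of_le_succ fun N => ?_
    rw [Finset.prod_range_succ]
    refine le_mul_of_one_le_right (Finset.prod_nonneg fun i _ => ?_) ?_
    · have := mul_nonneg hx (pow_nonneg hq0.le i); linarith
    · have := mul_nonneg hx (pow_nonneg hq0.le N); linarith
  simpa [qPoch] using hmono.ge_of_tendsto hm N

theorem one_le_qPoch_neg (hq0 : 0 < q) (hq1 : q < 1) {x : ℝ} (hx : 0 ≤ x) :
    1 ≤ qPoch (-x) q := by
  simpa using prod_range_le_qPoch_neg hq0 hq1 hx 0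

theorem pow_mul_one_add_pow_le_qPoch_neg (hq0 : 0 < q) (hq1 : q < 1) {x : ℝ} (hx : 0 ≤ x)
    (N : ℕ) : (q ^ N) ^ N * (1 + x) ^ N ≤ qPoch (-x) q := by
  refine le_trans ?_ (prod_range_le_qPoch_neg hq0 hq1 hx N)
  rw [← mul_pow]
  have : ∏ _k ∈ Finset.range N, (q ^ N * (1 + x)) = (q ^ N * (1 + x)) ^ N := by simp
  rw [← this]
  refine Finset.prod_le_prod (fun i _ => by positivity) fun i hi => ?_
  have h1 : q ^ N ≤ q ^ i := pow_le_pow_of_le_one hq0.le hq1.le (Finset.mem_range.1 hi).le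
  have h2 : q ^ N ≤ 1 := pow_le_one₀ hq0.le hq1.le
  nlinarith

theorem measurable_qPoch (hq0 : 0 < q) (hq1 : q < 1) : Measurable fun x => qPoch x q := by
  refine measurable_of_tendsto_metrizable (f := fun N x => ∏ k ∈ Finset.range N, (1 - x * q ^ k))
    (fun N => by fun_prop) ?_
  rw [tendsto_pi_nhds]
  exact fun x => (multipliable_qPoch hq0 hq1 x).hasProd.tendsto_prod_nat

end QPoch

/-- Askey's weight with parameter `1 / 2`. -/
noncomputable def askeyWeight (q x : ℝ) : ℝ :=
  x ^ ((1 : ℝ) / 2) / (qPoch (-x) q * qPoch (-(q / x)) q)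

section Askey

variable {q : ℝ}

theorem askeyWeight_pos (hq0 : 0 < q) (hq1 : q < 1) {x : ℝ} (hx : 0 < x) :
    0 < askeyWeight q x := by
  have h1 := one_le_qPoch_neg hq0 hq1 hx.le
  have h2 := one_le_qPoch_neg hq0 hq1 (div_pos hq0 hx).le
  unfold askeyWeight
  positivity

theorem askeyWeight_mul (hq0 : 0 < q) (hq1 : q < 1) {x : ℝ} (hx : 0 < x) :
    askeyWeight q (q * x) = q ^ ((1 : ℝ) / 2) * x * askeyWeight q x := by
  have h1 := one_le_qPoch_neg hq0 hq1 (mul_pos hq0 hx).le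
  have h2 := one_le_qPoch_neg hq0 hq1 (div_pos hq0 hx).le
  have e1 : qPoch (-x) q = (1 + x) * qPoch (-(q * x)) q := by
    rw [qPoch_eq_one_sub_mul hq0 hq1 (-x)]
    congr 2 <;> ring
  have e2 : qPoch (-(q / (q * x))) q = (1 + 1 / x) * qPoch (-(q / x)) q := by
    rw [qPoch_eq_one_sub_mul hq0 hq1 (-(q / (q * x)))]
    congr 2 <;> field_simp
    ring
  unfold askeyWeight
  rw [e1, e2, Real.mul_rpow hq0.le hx.le]
  field_simp
  ring

theorem integrableOn_pow_mul_askeyWeight (hq0 : 0 < q) (hq1 : q < 1) (n : ℕ) :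
    IntegrableOn (fun x => x ^ n * askeyWeight q x) (Ioi 0) := by
  have hdom : Integrable fun x : ℝ =>
      ((q ^ (n + 3)) ^ (n + 3))⁻¹ * (1 + ‖x‖) ^ (-(2 : ℝ)) :=
    (integrable_one_add_norm (by simp)).const_mul _
  have hmeas : Measurable fun x => x ^ n * askeyWeight q x := by
    have h := measurable_qPoch hq0 hq1
    have h1 : Measurable fun x : ℝ => qPoch (-x) q := h.comp measurable_neg
    have h2 : Measurable fun x : ℝ => qPoch (-(q / x)) q :=
      h.comp (measurable_const.div measurable_id).neg
    unfold askeyWeight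
    fun_prop
  refine hdom.integrableOn.mono' hmeas.aestronglyMeasurable ?_
  filter_upwards [ae_restrict_mem measurableSet_Ioi] with x (hx : 0 < x)
  have h1 := pow_mul_one_add_pow_le_qPoch_neg hq0 hq1 hx.le (n + 3)
  have h2 := one_le_qPoch_neg hq0 hq1 (div_pos hq0 hx).le
  have h3 : x ^ ((1 : ℝ) / 2) ≤ 1 + x := by
    rw [← Real.sqrt_eq_rpow, Real.sqrt_le_left (by positivity)]
    nlinarith
  have h4 : x ^ n ≤ (1 + x) ^ n := by gcongr; linarith
  rw [Real.norm_of_nonneg (mul_nonneg (by positivity) (askeyWeight_pos hq0 hq1 hx).le),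
    Real.norm_of_nonneg hx.le, Real.rpow_neg (by positivity), Real.rpow_two]
  have h5 := one_le_qPoch_neg hq0 hq1 hx.le
  unfold askeyWeight
  calc x ^ n * (x ^ ((1 : ℝ) / 2) / (qPoch (-x) q * qPoch (-(q / x)) q))
      ≤ (1 + x) ^ n * ((1 + x) / ((q ^ (n + 3)) ^ (n + 3) * (1 + x) ^ (n + 3) * 1)) := by
        gcongr ?_ * ?_
        exact div_le_div₀ (by positivity) h3 (by positivity)
          (mul_le_mul h1 h2 zero_le_one (by positivity))
    _ = ((q ^ (n + 3)) ^ (n + 3))⁻¹ * ((1 + x) ^ 2)⁻¹ := by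
        field_simp
        ring

theorem integral_askeyWeight_pos (hq0 : 0 < q) (hq1 : q < 1) :
    0 < ∫ x in Ioi (0 : ℝ), askeyWeight q x := by
  have hint : IntegrableOn (askeyWeight q) (Ioi 0) := by
    simpa using integrableOn_pow_mul_askeyWeight hq0 hq1 0
  rw [setIntegral_pos_iff_support_of_nonneg_ae _ hint]
  · have : Function.support (askeyWeight q) ∩ Ioi 0 = Ioi 0 :=
      inter_eq_right.2 fun x hx => (askeyWeight_pos hq0 hq1 hx).ne'
    simp [this]
  · filter_upwards [ae_restrict_mem measurableSet_Ioi] with x hx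
    exact (askeyWeight_pos hq0 hq1 hx).le

theorem integral_pow_succ_mul_askeyWeight (hq0 : 0 < q) (hq1 : q < 1) (n : ℕ) :
    ∫ x in Ioi (0 : ℝ), x ^ (n + 1) * askeyWeight q x =
      q ^ (-(n : ℝ) - 3 / 2) * ∫ x in Ioi (0 : ℝ), x ^ n * askeyWeight q x := by
  have h := integral_comp_mul_left_Ioi (fun x => x ^ n * askeyWeight q x) 0 hq0
  have h2 : ∫ x in Ioi (0 : ℝ), (q * x) ^ n * askeyWeight q (q * x) =
      q ^ n * q ^ ((1 : ℝ) / 2) * ∫ x in Ioi (0 : ℝ), x ^ (n + 1) * askeyWeight q x := by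
    rw [← integral_const_mul]
    refine setIntegral_congr_fun measurableSet_Ioi fun x hx => ?_
    simp only [askeyWeight_mul hq0 hq1 hx]
    ring
  rw [h2, mul_zero, smul_eq_mul] at h
  have h3 : q ^ (-(n : ℝ) - 3 / 2) * (q ^ n * q ^ ((1 : ℝ) / 2)) = q⁻¹ := by
    rw [← Real.rpow_natCast, ← Real.rpow_add hq0, ← Real.rpow_add hq0, ← Real.rpow_neg_one]
    congr 1
    ring
  have h4 : q ^ (-(n : ℝ) - 3 / 2) * (q ^ n * q ^ ((1 : ℝ) / 2)) * q = 1 := by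
    rw [h3, inv_mul_cancel₀ hq0.ne']
  have h5 : ∫ x in Ioi (0 : ℝ), x ^ n * askeyWeight q x =
      q * (q ^ n * q ^ ((1 : ℝ) / 2) *
        ∫ x in Ioi (0 : ℝ), x ^ (n + 1) * askeyWeight q x) := by
    rw [h]
    field_simp
  rw [h5]
  linear_combination (-∫ x in Ioi (0 : ℝ), x ^ (n + 1) * askeyWeight q x) * h4

theorem integral_pow_mul_askeyWeight (hq0 : 0 < q) (hq1 : q < 1) (n : ℕ) :
    ∫ x in Ioi (0 : ℝ), x ^ n * askeyWeight q x =
      q ^ (-(n : ℝ) ^ 2 / 2 - (n : ℝ)) * ∫ x in Ioi (0 : ℝ), askeyWeight q x := by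
  induction n with
  | zero => simp
  | succ n ih =>
    rw [integral_pow_succ_mul_askeyWeight hq0 hq1, ih, ← mul_assoc, ← Real.rpow_add hq0]
    congr 2
    push_cast
    ring

end Askey

/-- The Stieltjes-Wigert weight and Askey's weight with `α = 1/2` have the same
normalized moment sequence `q^{-n²/2-n}`, hence the same monic orthogonal polynomials. -/
theorem askey_stieltjes_wigert_same_moments
    (k : ℝ) (hk : 0 < k) (q : ℝ) (hq : q = Real.exp (-1 / (2 * k ^ 2)))
    (wSW : ℝ → ℝ)
    (hwSW : ∀ x : ℝ, wSW x = k / Real.sqrt Real.pi * Real.exp (-k ^ 2 * Real.log x ^ 2))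
    (wA : ℝ → ℝ)
    (hwA : ∀ x : ℝ, 0 < x →
      wA x = x ^ ((1 : ℝ) / 2) / (qPoch (-x) q * qPoch (-(q / x)) q))
    (μ m : ℕ → ℝ)
    (hμ : ∀ n : ℕ, μ n = ∫ x in Ioi (0 : ℝ), x ^ n * wSW x)
    (hm : ∀ n : ℕ, m n = ∫ x in Ioi (0 : ℝ), x ^ n * wA x) :
    (∀ n : ℕ, μ n / μ 0 = q ^ (-(n : ℝ) ^ 2 / 2 - (n : ℝ)) ∧
      m n / m 0 = q ^ (-(n : ℝ) ^ 2 / 2 - (n : ℝ))) ∧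
    (∀ P Q : ℕ → Polynomial ℝ,
      (∀ n, (P n).Monic) → (∀ n, (P n).natDegree = n) →
      (∀ i j : ℕ, i ≠ j →
        ∫ x in Ioi (0 : ℝ), (P i).eval x * (P j).eval x * wSW x = 0) →
      (∀ n, (Q n).Monic) → (∀ n, (Q n).natDegree = n) →
      (∀ i j : ℕ, i ≠ j →
        ∫ x in Ioi (0 : ℝ), (Q i).eval x * (Q j).eval x * wA x = 0) →
      P = Q) := by
  have hq0 : 0 < q := hq ▸ Real.exp_pos _
  have hq1 : q < 1 := by
    rw [hq, Real.exp_lt_one_iff]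
    exact div_neg_of_neg_of_pos (by norm_num) (by positivity)
  have hSWint : ∀ n : ℕ, IntegrableOn (fun x => x ^ n * wSW x) (Ioi 0) := by
    simpa only [hwSW] using integrableOn_pow_mul_stieltjesWigert hk
  have hAeq : ∀ n : ℕ, EqOn (fun x => x ^ n * askeyWeight q x) (fun x => x ^ n * wA x) (Ioi 0) :=
    fun n x hx => by simp only [hwA x hx, askeyWeight]
  have hAint : ∀ n : ℕ, IntegrableOn (fun x => x ^ n * wA x) (Ioi 0) := fun n =>
    (integrableOn_pow_mul_askeyWeight hq0 hq1 n).congr_fun (hAeq n) measurableSet_Ioi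
  have hμval : ∀ n : ℕ, μ n = Real.exp (((n : ℝ) + 1) ^ 2 / (4 * k ^ 2)) := fun n => by
    simp only [hμ, hwSW, integral_pow_mul_stieltjesWigert hk]
  have hμ0 : 0 < μ 0 := hμval 0 ▸ Real.exp_pos _
  have hmval : ∀ n : ℕ, m n = q ^ (-(n : ℝ) ^ 2 / 2 - (n : ℝ)) *
      ∫ x in Ioi (0 : ℝ), askeyWeight q x := fun n => by
    rw [hm, ← setIntegral_congr_fun measurableSet_Ioi (hAeq n),
      integral_pow_mul_askeyWeight hq0 hq1]
  have hm0 : 0 < m 0 := by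
    simpa [hmval 0] using integral_askeyWeight_pos hq0 hq1
  have hμratio : ∀ n : ℕ, μ n / μ 0 = q ^ (-(n : ℝ) ^ 2 / 2 - (n : ℝ)) := fun n => by
    rw [hμval, hμval, ← Real.exp_sub, hq, ← Real.exp_mul]
    congr 1
    push_cast
    field_simp
    ring
  have hmratio : ∀ n : ℕ, m n / m 0 = q ^ (-(n : ℝ) ^ 2 / 2 - (n : ℝ)) := fun n => by
    rw [div_eq_iff hm0.ne', hmval n, hmval 0]
    simp
  refine ⟨fun n => ⟨hμratio n, hmratio n⟩, fun P Q hP hPdeg hPorth hQ hQdeg hQorth => ?_⟩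
  have hprop : ∀ n : ℕ, ∫ x in Ioi (0 : ℝ), x ^ n * wSW x =
      μ 0 / m 0 * ∫ x in Ioi (0 : ℝ), x ^ n * wA x := fun n => by
    rw [← hμ, ← hm, (div_eq_iff hμ0.ne').1 (hμratio n), (div_eq_iff hm0.ne').1 (hmratio n)]
    field_simp
  have hSWpos : ∀ x, 0 < x → 0 < wSW x := fun x _ => by
    rw [hwSW]
    have := Real.sqrt_pos.2 Real.pi_pos
    positivity
  refine Polynomial.monic_orthogonal_unique (momentFunctional _ wSW hSWint)
    (eq_zero_of_integral_sq_mul_eq_zero hSWpos hSWint) P Q hP hPdeg (fun i j hij => ?_)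
    hQ hQdeg fun i j hij => ?_
  · simpa [momentFunctional] using hPorth i j hij
  · rw [momentFunctional_eq_const_mul hSWint hAint hprop]
    simp [momentFunctional, hQorth i j hij]
end

section
/- Let k > 0 and q = exp(−1/(2k²)), and let (P_n) be the monic orthogonal polynomials with respect to the Stieltjes–Wigert weight w_k(x) = (k/√π) exp(−k²(log x)²) on (0,∞). Then the three-term recurrence coefficients are b_n = q^{−2n−3/2}(1 + q − q^{n+1}) and a_n² = q^{−4n}(1 − qⁿ) for all n ≥ 0. -/
open MeasureTheory Set

namespace StieltjesWigert

open Polynomial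

lemma exp_mul_weight_comp_exp {k : ℝ} (hk : 0 < k) (m : ℕ) (t : ℝ) :
    Real.exp t * (Real.exp t ^ m * (k / √Real.pi * Real.exp (-k ^ 2 * Real.log (Real.exp t) ^ 2)))
      = k / √Real.pi * Real.exp (1 / (4 * k ^ 2)) ^ (m + 1) ^ 2 *
        Real.exp (-k ^ 2 * (t - (m + 1) / (2 * k ^ 2)) ^ 2) := by
  have h : Real.exp t * Real.exp t ^ m * Real.exp (-k ^ 2 * t ^ 2)
      = Real.exp (1 / (4 * k ^ 2)) ^ (m + 1) ^ 2 *
        Real.exp (-k ^ 2 * (t - (m + 1) / (2 * k ^ 2)) ^ 2) := by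
    rw [← Real.exp_nat_mul, ← Real.exp_nat_mul, ← Real.exp_add, ← Real.exp_add, ← Real.exp_add]
    congr 1
    push_cast
    field_simp
    ring
  rw [Real.log_exp]
  linear_combination k / √Real.pi * h

lemma integrableOn_pow_mul_weight {k : ℝ} (hk : 0 < k) (m : ℕ) :
    IntegrableOn (fun x : ℝ ↦ x ^ m * (k / √Real.pi * Real.exp (-k ^ 2 * Real.log x ^ 2)))
      (Ioi 0) := by
  rw [← Real.range_exp, ← image_univ,
    integrableOn_image_iff_integrableOn_abs_deriv_smul MeasurableSet.univ
      (fun x _ ↦ (Real.hasDerivAt_exp x).hasDerivWithinAt) Real.exp_injective.injOn,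
    integrableOn_univ]
  simp only [Real.abs_exp, smul_eq_mul, exp_mul_weight_comp_exp hk]
  exact ((integrable_exp_neg_mul_sq (by positivity)).comp_sub_right _).const_mul _

lemma integral_pow_mul_weight {k : ℝ} (hk : 0 < k) (m : ℕ) :
    ∫ x in Ioi (0 : ℝ), x ^ m * (k / √Real.pi * Real.exp (-k ^ 2 * Real.log x ^ 2))
      = Real.exp (1 / (4 * k ^ 2)) ^ (m + 1) ^ 2 := by
  rw [← Real.range_exp, ← image_univ,
    integral_image_eq_integral_abs_deriv_smul MeasurableSet.univ
      (fun x _ ↦ (Real.hasDerivAt_exp x).hasDerivWithinAt) Real.exp_injective.injOn,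
    setIntegral_univ]
  simp only [Real.abs_exp, smul_eq_mul, exp_mul_weight_comp_exp hk]
  rw [integral_const_mul, integral_sub_right_eq_self (fun t ↦ Real.exp (-k ^ 2 * t ^ 2)),
    integral_gaussian, Real.sqrt_div Real.pi_pos.le, Real.sqrt_sq hk.le]
  have := Real.sqrt_pos.2 Real.pi_pos
  field_simp

lemma integrableOn_eval_mul {w : ℝ → ℝ} {s : Set ℝ}
    (hw : ∀ m : ℕ, IntegrableOn (fun x ↦ x ^ m * w x) s) (p : ℝ[X]) :
    IntegrableOn (fun x ↦ p.eval x * w x) s := by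
  induction p using Polynomial.induction_on' with
  | add p r hp hr =>
    simp only [eval_add, add_mul]
    exact hp.add hr
  | monomial n c =>
    simp only [eval_monomial, mul_assoc]
    exact (hw n).const_mul c

/-- The functional `p ↦ ∫ x in s, p(x) w(x)` for a weight `w` with finite moments on `s`. -/
noncomputable def weightFunctional (w : ℝ → ℝ) (s : Set ℝ)
    (hw : ∀ m : ℕ, IntegrableOn (fun x ↦ x ^ m * w x) s) : ℝ[X] →ₗ[ℝ] ℝ where
  toFun p := ∫ x in s, p.eval x * w x
  map_add' p r := by
    simp only [eval_add, add_mul]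
    exact integral_add (integrableOn_eval_mul hw p) (integrableOn_eval_mul hw r)
  map_smul' c p := by
    simp only [eval_smul, smul_eq_mul, mul_assoc, integral_const_mul, RingHom.id_apply]

/-- A monic orthogonal sequence is orthogonal to every polynomial of lower degree. -/
lemma map_mul_eq_zero_of_degree_lt {L : ℝ[X] →ₗ[ℝ] ℝ} {P : ℕ → ℝ[X]}
    (hmonic : ∀ n, (P n).Monic) (hdeg : ∀ n, (P n).natDegree = n)
    (horth : ∀ m n : ℕ, m ≠ n → L (P m * P n) = 0) {n : ℕ} :
    ∀ (d : ℕ) (r : ℝ[X]), d ≤ n → r.degree < d → L (P n * r) = 0 := by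
  intro d
  induction d with
  | zero =>
    intro r _ hr
    have : r = 0 := by simpa using hr
    simp [this]
  | succ d ih =>
    intro r hd hr
    have hlow : (r - C (r.coeff d) * P d).degree < d := by
      rw [degree_lt_iff_coeff_zero]
      intro j hj
      rcases hj.eq_or_lt with rfl | hj
      · have : (P d).coeff d = 1 := by
          have := (hmonic d).coeff_natDegree
          rwa [hdeg] at this
        simp [this]
      · have h1 : (P d).coeff j = 0 := coeff_eq_zero_of_natDegree_lt (by rw [hdeg]; exact hj)
        have h2 : r.coeff j = 0 := (degree_lt_iff_coeff_zero r (d + 1)).1 hr j hj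
        simp [h1, h2]
    have h := ih _ (by omega) hlow
    have hsplit : P n * r = P n * (r - C (r.coeff d) * P d) + r.coeff d • (P n * P d) := by
      rw [smul_eq_C_mul]; ring
    rw [hsplit, map_add, map_smul, h, horth n d (by omega)]
    simp

/-- The closed form of the mixed moments `∫ Pₙ(x) xᵐ w(x) dx`, where `s = q^(-1/2)`. -/
noncomputable def mixedMoment (s : ℝ) (n m : ℕ) : ℝ :=
  s ^ ((m + 1) ^ 2 + n ^ 2 + 2 * n) * ∏ j ∈ Finset.range n, (s ^ (2 * m) - s ^ (2 * j))

lemma mixedMoment_eq_zero (s : ℝ) {n m : ℕ} (h : m < n) : mixedMoment s n m = 0 := by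
  rw [mixedMoment, Finset.prod_eq_zero (Finset.mem_range.2 h) (sub_self _), mul_zero]

lemma mixedMoment_self_pos {s : ℝ} (hs : 1 < s) (n : ℕ) : 0 < mixedMoment s n n := by
  refine mul_pos (by positivity) (Finset.prod_pos fun j hj ↦ sub_pos.2 ?_)
  have := Finset.mem_range.1 hj
  exact pow_lt_pow_right₀ hs (by omega)

lemma mixedMoment_zero_succ (s : ℝ) (m : ℕ) :
    mixedMoment s 0 (m + 1) = mixedMoment s 1 m + s ^ 3 * mixedMoment s 0 m := by
  simp [mixedMoment]
  ring

lemma prod_pow_succ_sub (s : ℝ) (n m : ℕ) :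
    ∏ j ∈ Finset.range (n + 1), (s ^ (2 * (m + 1)) - s ^ (2 * j))
      = s ^ (2 * n) * (s ^ (2 * m + 2) - 1) *
        ∏ j ∈ Finset.range n, (s ^ (2 * m) - s ^ (2 * j)) := by
  have h (j : ℕ) : s ^ (2 * (m + 1)) - s ^ (2 * (j + 1))
      = s ^ 2 * (s ^ (2 * m) - s ^ (2 * j)) := by ring
  rw [Finset.prod_range_succ', Finset.prod_congr rfl fun j _ ↦ h j, Finset.prod_mul_distrib]
  simp
  ring

lemma mixedMoment_succ_succ (s : ℝ) (n m : ℕ) :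
    mixedMoment s (n + 1) (m + 1) = mixedMoment s (n + 2) m
      + s ^ (2 * n + 3) * (s ^ (2 * n + 4) + s ^ (2 * n + 2) - 1) * mixedMoment s (n + 1) m
      + s ^ (6 * (n + 1)) * (s ^ (2 * (n + 1)) - 1) * mixedMoment s n m := by
  simp only [mixedMoment]
  rw [prod_pow_succ_sub, Finset.prod_range_succ _ (n + 1), Finset.prod_range_succ _ n]
  generalize ∏ j ∈ Finset.range n, (s ^ (2 * m) - s ^ (2 * j)) = p
  ring

/-- A triangular array of mixed moments with the Stieltjes-Wigert initial row determines the
coefficients of its recurrence. -/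
lemma recurrence_coefficients_of_moments {s : ℝ} (hs : 1 < s) {u : ℕ → ℕ → ℝ} {b a : ℕ → ℝ}
    (hu0 : ∀ m, u 0 m = s ^ (m + 1) ^ 2) (hlow : ∀ n m, m < n → u n m = 0) (ha0 : a 0 = 0)
    (hrec : ∀ n m, u n (m + 1) = u (n + 1) m + b n * u n m + a n * u (n - 1) m) (n : ℕ) :
    b n = s ^ (2 * n + 1) * (s ^ (2 * n + 2) + s ^ (2 * n) - 1) ∧
      a n = s ^ (6 * n) * (s ^ (2 * n) - 1) := by
  have h0 (m : ℕ) : u 0 m = mixedMoment s 0 m := by simp [hu0, mixedMoment]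
  have hb0 : b 0 = s ^ 3 := by
    have h1 := hrec 0 0
    rw [hlow 1 0 one_pos, ha0, h0, h0, mixedMoment_zero_succ,
      mixedMoment_eq_zero s one_pos] at h1
    exact mul_right_cancel₀ (mixedMoment_self_pos hs 0).ne' (by linarith)
  have hstep (n : ℕ) (hn : ∀ m, u n m = mixedMoment s n m)
      (hn1 : ∀ m, u (n + 1) m = mixedMoment s (n + 1) m) :
      b (n + 1) = s ^ (2 * n + 3) * (s ^ (2 * n + 4) + s ^ (2 * n + 2) - 1) ∧
        a (n + 1) = s ^ (6 * (n + 1)) * (s ^ (2 * (n + 1)) - 1) := by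
    have h1 := hrec (n + 1) n
    have h2 := hrec (n + 1) (n + 1)
    rw [hlow (n + 2) n (by omega), Nat.add_sub_cancel, hn, hn1, hn1, mixedMoment_succ_succ,
      mixedMoment_eq_zero s (show n < n + 2 by omega),
      mixedMoment_eq_zero s (show n < n + 1 by omega)] at h1
    have ha := mul_right_cancel₀ (mixedMoment_self_pos hs n).ne'
      (show a (n + 1) * _ = (s ^ (6 * (n + 1)) * (s ^ (2 * (n + 1)) - 1)) * _ by linarith)
    rw [hlow (n + 2) (n + 1) (by omega), Nat.add_sub_cancel, hn, hn1, hn1, mixedMoment_succ_succ,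
      mixedMoment_eq_zero s (show n + 1 < n + 2 by omega), ha] at h2
    exact ⟨mul_right_cancel₀ (mixedMoment_self_pos hs (n + 1)).ne' (by linarith), ha⟩
  have hu (n : ℕ) : (∀ m, u n m = mixedMoment s n m) ∧
      ∀ m, u (n + 1) m = mixedMoment s (n + 1) m := by
    induction n with
    | zero =>
      refine ⟨h0, fun m ↦ ?_⟩
      have h1 := hrec 0 m
      rw [ha0, hb0, h0, h0, mixedMoment_zero_succ] at h1
      linarith
    | succ n ih =>
      refine ⟨ih.2, fun m ↦ ?_⟩
      obtain ⟨hb, ha⟩ := hstep n ih.1 ih.2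
      have h1 := hrec (n + 1) m
      rw [hb, ha, Nat.add_sub_cancel, ih.1, ih.2, ih.2, mixedMoment_succ_succ] at h1
      linarith
  cases n with
  | zero => simp [hb0, ha0]; ring
  | succ n => exact hstep n (hu n).1 (hu n).2

end StieltjesWigert

/-- Recurrence coefficients of the monic Stieltjes-Wigert polynomials:
`b_n = q^{-2n-3/2}(1+q-q^{n+1})` and `a_n² = q^{-4n}(1-qⁿ)`. -/
theorem stieltjes_wigert_recurrence_coefficients
    (k : ℝ) (hk : 0 < k) (q : ℝ) (hq : q = Real.exp (-1 / (2 * k ^ 2)))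
    (w : ℝ → ℝ)
    (hw : ∀ x : ℝ, w x = k / Real.sqrt Real.pi * Real.exp (-k ^ 2 * Real.log x ^ 2))
    (P : ℕ → Polynomial ℝ)
    (hmonic : ∀ n, (P n).Monic)
    (hdeg : ∀ n, (P n).natDegree = n)
    (horth : ∀ m n : ℕ, m ≠ n →
      ∫ x in Ioi (0 : ℝ), (P m).eval x * (P n).eval x * w x = 0)
    (b a2 : ℕ → ℝ)
    (ha0 : a2 0 = 0) (hapos : ∀ n : ℕ, 1 ≤ n → 0 < a2 n)
    (hrec : ∀ n : ℕ, ∀ x : ℝ,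
      x * (P n).eval x
        = (P (n + 1)).eval x + b n * (P n).eval x + a2 n * (P (n - 1)).eval x) :
    ∀ n : ℕ,
      b n = q ^ (-2 * (n : ℝ) - 3 / 2) * (1 + q - q ^ ((n : ℝ) + 1)) ∧
      a2 n = q ^ (-4 * (n : ℝ)) * (1 - q ^ (n : ℝ)) := by
  intro n
  have hweq : w = fun x ↦ k / √Real.pi * Real.exp (-k ^ 2 * Real.log x ^ 2) := funext hw
  set s := Real.exp (1 / (4 * k ^ 2)) with hs
  have hs1 : 1 < s := Real.one_lt_exp_iff.2 (by positivity)
  have hs0 : 0 < s := by positivity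
  have hmoments (m : ℕ) : IntegrableOn (fun x ↦ x ^ m * w x) (Ioi 0) := by
    simpa only [hweq] using StieltjesWigert.integrableOn_pow_mul_weight hk m
  let L := StieltjesWigert.weightFunctional w (Ioi 0) hmoments
  have hL (p : Polynomial ℝ) : L p = ∫ x in Ioi (0 : ℝ), p.eval x * w x := rfl
  have hLorth (m n : ℕ) (h : m ≠ n) : L (P m * P n) = 0 := by
    simpa only [hL, Polynomial.eval_mul] using horth m n h
  have hPrec (n : ℕ) : Polynomial.X * P n = P (n + 1) + b n • P n + a2 n • P (n - 1) :=
    Polynomial.funext fun x ↦ by simpa using hrec n x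
  have hP0 : P 0 = 1 := (hmonic 0).natDegree_eq_zero.1 (hdeg 0)
  obtain ⟨hb, ha⟩ := StieltjesWigert.recurrence_coefficients_of_moments hs1
    (u := fun n m ↦ L (P n * Polynomial.X ^ m)) (b := b) (a := a2)
    (fun m ↦ by
      simp only [hL, hP0, hweq, one_mul, Polynomial.eval_pow, Polynomial.eval_X]
      exact StieltjesWigert.integral_pow_mul_weight hk m)
    (fun n m h ↦ StieltjesWigert.map_mul_eq_zero_of_degree_lt hmonic hdeg hLorth n _ le_rfl
      (by rw [Polynomial.degree_X_pow]; exact_mod_cast h))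
    ha0
    (fun n m ↦ by
      have h : P n * Polynomial.X ^ (m + 1) = P (n + 1) * Polynomial.X ^ m
          + b n • (P n * Polynomial.X ^ m) + a2 n • (P (n - 1) * Polynomial.X ^ m) := by
        rw [← smul_mul_assoc, ← smul_mul_assoc, ← add_mul, ← add_mul, ← hPrec]
        ring
      simp only [h, map_add, map_smul, smul_eq_mul]) n
  have hqs (y : ℝ) : q ^ y = s ^ (-2 * y) := by
    rw [hq, hs, ← Real.exp_mul, ← Real.exp_mul]
    congr 1
    field_simp
    ring
  have hq1 : q = s ^ (-2 : ℝ) := by simpa using hqs 1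
  rw [hb, ha, hqs, hqs, hqs, hqs, hq1]
  simp only [← Real.rpow_natCast, mul_sub, mul_add, mul_one, ← Real.rpow_add hs0]
  push_cast
  constructor <;> ring_nf
end

section
/- Let 0<q<1, α ∈ ℝ, p > 0, and let real sequences (δ_n)_{n≥0}, (b_n)_{n≥0}, (a_n²)_{n≥0}, (t_n)_{n≥0}, (T_n)_{n≥0}, (r_n)_{n≥0} satisfy δ_0 = t_0 = r_0 = 0, a_0² = 0, T_n = q^{n−1}(δ_n − q δ_{n+1}), r_n = q^{n−1}(1−q) δ_n, b_n = δ_n − δ_{n+1} for all n ≥ 0, and the compatibility equations: (i) t_{n+1} + t_n + p q^{−2}(−1 + qⁿ + q^{n+1}) = −b_n T_n + q^{−α} for n ≥ 0; (ii) −b_n(t_{n+1} − t_n) + b_n qⁿ (1−q) p q^{−2} = a_{n+1}² T_{n+1} − a_n² T_{n−1} for n ≥ 1, together with −b_0 t_1 + b_0 (1−q) p q^{−2} = a_1² T_1; (iii) t_{n+1} − q t_n − b_n r_{n+1} + b_n r_n = a_{n+1}² q^{n+1} − a_n² q^{n−1} for n ≥ 0. Define y_n := t_n − q^{−α} − p q^{−2}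 + p q^{n−2}. Then for all n ≥ 0, T_n² = q^{2n+α} (y_n y_{n+1} − p q^{−2−α}), and for all n ≥ 1 the sequence (y_n) satisfies the q-discrete Painlevé V equation in the multiplied form (y_n y_{n−1} − p q^{−2−α})(y_n y_{n+1} − p q^{−2−α})(q^{n+α} y_n + 1)² = (y_n + q^{−α})² (y_n + p q^{−2})². -/
/-- The first integral of the third compatibility relation. -/
theorem qLaguerre_recurrence_coeff {q A P : ℝ} {δ a2 T y : ℕ → ℝ}
    (hq : q ≠ 0) (hy0 : y 0 = -A) (ha0 : a2 0 = 0)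
    (h1 : ∀ n, y (n + 1) + y n + A + P = -(δ n - δ (n + 1)) * T n)
    (h3 : ∀ n, y (n + 1) - q * y n + (1 - q) * (A + P) + (1 - q) * (δ n - δ (n + 1)) * T n
      = a2 (n + 1) * (q ^ n * q) - a2 n * (q ^ n / q)) (n : ℕ) :
    (q ^ n) ^ 2 * a2 n = q * (q ^ n * y n + A) := by
  induction n with
  | zero => simp [hy0, ha0]
  | succ n ih =>
    have e1 := h1 n
    have e3 := h3 n
    have hd : q ^ n / q * q = q ^ n := div_mul_cancel₀ _ hq
    rw [pow_succ]
    linear_combination (-(q * q ^ n)) * e3 + ih + ((1 - q) * q * q ^ n) * e1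
      + (a2 n * q ^ n) * hd

/-- The first integral of the second compatibility relation. -/
theorem qLaguerre_mul_eq {A P : ℝ} {δ a2 T y : ℕ → ℝ}
    (hy0 : y 0 = -A)
    (h1 : ∀ n, y (n + 1) + y n + A + P = -(δ n - δ (n + 1)) * T n)
    (h2 : ∀ n, -(δ (n + 1) - δ (n + 2)) * (y (n + 2) - y (n + 1))
      = a2 (n + 2) * T (n + 2) - a2 (n + 1) * T n)
    (h20 : -(δ 0 - δ 1) * (y 1 - y 0) = a2 1 * T 1) (n : ℕ) :
    (y (n + 1) + A) * (y (n + 1) + P) = a2 (n + 1) * T (n + 1) * T n := by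
  induction n with
  | zero =>
    have e1 := h1 0
    rw [hy0] at e1 h20
    rw [zero_add] at *
    linear_combination (y 1 + A) * e1 + T 0 * h20
  | succ n ih =>
    linear_combination ih + (y (n + 2) - y (n + 1)) * h1 (n + 1) + T (n + 1) * h2 n

/-- The linear relation between consecutive `T n`, with `δ` in place of the scaled `r`. -/
theorem qLaguerre_linear {q A : ℝ} {δ a2 T y : ℕ → ℝ}
    (hq : q ≠ 0) (hδ0 : δ 0 = 0) (hy0 : y 0 = -A)
    (hT : ∀ n, q * T n = q ^ n * (δ n - q * δ (n + 1)))
    (ha : ∀ n, (q ^ n) ^ 2 * a2 n = q * (q ^ n * y n + A))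
    (h2 : ∀ n, -(δ (n + 1) - δ (n + 2)) * (y (n + 2) - y (n + 1))
      = a2 (n + 2) * T (n + 2) - a2 (n + 1) * T n)
    (h20 : -(δ 0 - δ 1) * (y 1 - y 0) = a2 1 * T 1) (n : ℕ) :
    (A + q ^ (n + 1) * y (n + 1)) * (T (n + 1) + q * T n)
      = q ^ (n + 1) * y (n + 1) * (q ^ n * (1 - q) * δ (n + 1)) := by
  induction n with
  | zero =>
    have e := hT 0
    have e' : T 0 = -δ 1 := by
      apply mul_left_cancel₀ hq
      simp only [hδ0, pow_zero, zero_add] at e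
      linear_combination e
    have ea := ha 1
    simp only [zero_add, pow_one, pow_zero, hδ0, hy0, e'] at *
    apply mul_left_cancel₀ hq
    linear_combination (-T 1) * ea - q ^ 2 * h20
  | succ n ih =>
    have e := hT (n + 1)
    have ea := ha (n + 1)
    have eb := ha (n + 2)
    have h := h2 n
    have hT1 : T (n + 1) = q ^ n * (δ (n + 1) - q * δ (n + 2)) := by
      apply mul_left_cancel₀ hq
      rw [e]; ring
    apply mul_left_cancel₀ hq
    have hz : q ^ (n + 1) = q ^ n * q := pow_succ q n
    have hw : q ^ (n + 1 + 1) = q ^ n * q * q := by ring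
    simp only [hw, hz, show n + 1 + 1 = n + 2 from rfl] at *
    linear_combination (-T (n + 2)) * eb - q ^ 2 * (q ^ n * q) ^ 2 * h + q ^ 2 * T n * ea
      + q ^ 2 * ih - (q ^ 2 * (q ^ n * q) * (y (n + 1) - q * y (n + 2))) * hT1

/-- The quadratic relation and q-Painlevé V, for normalized data. -/
theorem qLaguerre_qPV_aux {q A P : ℝ} {δ a2 T y : ℕ → ℝ}
    (hq : q ≠ 0) (hδ0 : δ 0 = 0) (hy0 : y 0 = -A) (ha0 : a2 0 = 0)
    (hT : ∀ n, q * T n = q ^ n * (δ n - q * δ (n + 1)))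
    (h1 : ∀ n, y (n + 1) + y n + A + P = -(δ n - δ (n + 1)) * T n)
    (h2 : ∀ n, -(δ (n + 1) - δ (n + 2)) * (y (n + 2) - y (n + 1))
      = a2 (n + 2) * T (n + 2) - a2 (n + 1) * T n)
    (h20 : -(δ 0 - δ 1) * (y 1 - y 0) = a2 1 * T 1)
    (h3 : ∀ n, y (n + 1) - q * y n + (1 - q) * (A + P) + (1 - q) * (δ n - δ (n + 1)) * T n
      = a2 (n + 1) * (q ^ n * q) - a2 n * (q ^ n / q)) :
    (∀ n, A * T n ^ 2 = (q ^ n) ^ 2 * (y n * y (n + 1) - P * A)) ∧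
    ∀ n, (y (n + 1) * y n - P * A) * (y (n + 1) * y (n + 2) - P * A)
        * (q ^ (n + 1) * y (n + 1) + A) ^ 2
      = A ^ 2 * ((y (n + 1) + A) ^ 2 * (y (n + 1) + P) ^ 2) := by
  have ha := qLaguerre_recurrence_coeff hq hy0 ha0 h1 h3
  have hm := qLaguerre_mul_eq hy0 h1 h2 h20
  have hl := qLaguerre_linear hq hδ0 hy0 hT ha h2 h20
  have hS : ∀ n, A * T n ^ 2 = (q ^ n) ^ 2 * (y n * y (n + 1) - P * A) := by
    rintro (_ | n)
    · have e := hT 0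
      have e1 := h1 0
      have e' : T 0 = -δ 1 := by
        apply mul_left_cancel₀ hq
        simp only [hδ0, pow_zero, zero_add] at e
        linear_combination e
      simp only [hδ0, hy0, e', zero_add, pow_zero] at *
      linear_combination A * e1
    · have e : T (n + 1) = q ^ n * (δ (n + 1) - q * δ (n + 2)) := by
        apply mul_left_cancel₀ hq
        rw [hT (n + 1)]; ring
      have e1 := h1 (n + 1)
      have ea := ha (n + 1)
      have el := hl n
      have em := hm n
      rw [show n + 1 + 1 = n + 2 from rfl] at *
      simp only [pow_succ q n] at *
      linear_combination T (n + 1) * el - (q ^ n * q) ^ 2 * y (n + 1) * e1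
        + (q ^ n * q) ^ 2 * em + T (n + 1) * T n * ea
        - q ^ n * q * y (n + 1) * T (n + 1) * e
  refine ⟨hS, fun n => ?_⟩
  have s0 := hS n
  have s1 := hS (n + 1)
  have ea := ha (n + 1)
  have em := hm n
  have hp : (q ^ n) ^ 2 * (q ^ (n + 1)) ^ 2 ≠ 0 := by positivity
  apply mul_left_cancel₀ hp
  rw [show n + 1 + 1 = n + 2 from rfl] at *
  calc _ = ((q ^ n) ^ 2 * (y n * y (n + 1) - P * A)) *
        ((q ^ (n + 1)) ^ 2 * (y (n + 1) * y (n + 2) - P * A))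
        * (q ^ (n + 1) * y (n + 1) + A) ^ 2 := by ring
    _ = A ^ 2 * (T n * T (n + 1)) ^ 2 * (q ^ (n + 1) * y (n + 1) + A) ^ 2 := by
      rw [← s0, ← s1]; ring
    _ = A ^ 2 * ((q ^ n) ^ 2 * (q ^ (n + 1)) ^ 2) *
        (a2 (n + 1) * T (n + 1) * T n) ^ 2 := by
      apply mul_left_cancel₀ (pow_ne_zero 2 hq)
      calc _ = A ^ 2 * (T n * T (n + 1)) ^ 2 *
              (q * (q ^ (n + 1) * y (n + 1) + A)) ^ 2 := by ring
        _ = _ := by rw [← ea]; ring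
    _ = _ := by rw [← em]; ring


/-- Ladder-operator compatibility relations for the semiclassical q-Laguerre weight
imply `T_n² = q^{2n+α}(y_n y_{n+1} - p q^{-2-α})` for `y_n = t_n - q^{-α} - pq^{-2} + pq^{n-2}`,
and that `y_n` satisfies q-Painlevé V in multiplied form. -/
theorem qLaguerre_ladder_qPV
    (q α p : ℝ) (hq0 : 0 < q) (hq1 : q < 1) (hp : 0 < p)
    (δ b a2 t T r : ℕ → ℝ)
    (hδ0 : δ 0 = 0) (ht0 : t 0 = 0) (hr0 : r 0 = 0) (ha0 : a2 0 = 0)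
    (hT : ∀ n : ℕ, T n = q ^ ((n : ℝ) - 1) * (δ n - q * δ (n + 1)))
    (hr : ∀ n : ℕ, r n = q ^ ((n : ℝ) - 1) * (1 - q) * δ n)
    (hb : ∀ n : ℕ, b n = δ n - δ (n + 1))
    (h1 : ∀ n : ℕ,
      t (n + 1) + t n + p * q ^ (-2 : ℝ) * (-1 + q ^ (n : ℝ) + q ^ ((n : ℝ) + 1))
        = -(b n) * T n + q ^ (-α))
    (h2 : ∀ n : ℕ, 1 ≤ n →
      -(b n) * (t (n + 1) - t n) + b n * q ^ (n : ℝ) * (1 - q) * p * q ^ (-2 : ℝ)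
        = a2 (n + 1) * T (n + 1) - a2 n * T (n - 1))
    (h20 : -(b 0) * t 1 + b 0 * (1 - q) * p * q ^ (-2 : ℝ) = a2 1 * T 1)
    (h3 : ∀ n : ℕ,
      t (n + 1) - q * t n - b n * r (n + 1) + b n * r n
        = a2 (n + 1) * q ^ ((n : ℝ) + 1) - a2 n * q ^ ((n : ℝ) - 1))
    (y : ℕ → ℝ)
    (hy : ∀ n : ℕ,
      y n = t n - q ^ (-α) - p * q ^ (-2 : ℝ) + p * q ^ ((n : ℝ) - 2)) :
    (∀ n : ℕ, T n ^ 2 = q ^ (2 * (n : ℝ) + α) * (y n * y (n + 1) - p * q ^ (-2 - α))) ∧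
    (∀ n : ℕ, 1 ≤ n →
      (y n * y (n - 1) - p * q ^ (-2 - α)) * (y n * y (n + 1) - p * q ^ (-2 - α))
          * (q ^ ((n : ℝ) + α) * y n + 1) ^ 2
        = (y n + q ^ (-α)) ^ 2 * (y n + p * q ^ (-2 : ℝ)) ^ 2) := by
  have hq : q ≠ 0 := hq0.ne'
  have hA : q ^ (-α) ≠ 0 := (Real.rpow_pos_of_pos hq0 _).ne'
  have eA : q ^ (-α) * q ^ α = 1 := by rw [← Real.rpow_add hq0]; simp
  have eP : p * q ^ (-2 - α) = p * q ^ (-2 : ℝ) * q ^ (-α) := by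
    rw [sub_eq_add_neg, Real.rpow_add hq0]; ring
  have p1 (n : ℕ) : q ^ ((n : ℝ) + 1) = q ^ n * q := by
    rw [Real.rpow_add hq0, Real.rpow_natCast, Real.rpow_one]
  have m1 (n : ℕ) : q ^ ((n : ℝ) - 1) = q ^ n / q := by
    rw [Real.rpow_sub hq0, Real.rpow_natCast, Real.rpow_one]
  have m2 (n : ℕ) : q ^ ((n : ℝ) - 2) = q ^ n * q ^ (-2 : ℝ) := by
    rw [sub_eq_add_neg, Real.rpow_add hq0, Real.rpow_natCast]
  have pα (n : ℕ) : q ^ ((n : ℝ) + α) = q ^ n * q ^ α := by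
    rw [Real.rpow_add hq0, Real.rpow_natCast]
  have p2 (n : ℕ) : q ^ (2 * (n : ℝ) + α) = (q ^ n) ^ 2 * q ^ α := by
    rw [two_mul, add_assoc, Real.rpow_add hq0, pα, Real.rpow_natCast]; ring
  simp only [p1, m1, m2, Real.rpow_natCast] at hT hr h1 h2 h3 hy
  simp only [p2, pα, eP]
  generalize q ^ (-α) = A at *
  generalize q ^ α = B at *
  generalize q ^ (-2 : ℝ) = s at *
  have ht (n : ℕ) : t n = y n + A + p * s - p * s * q ^ n := by rw [hy]; ring
  have hTq (n : ℕ) : q * T n = q ^ n * (δ n - q * δ (n + 1)) := by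
    rw [hT]; field_simp
  have hrd (n : ℕ) : r n - r (n + 1) = (1 - q) * T n := by
    rw [hr, hr, hT, pow_succ]; field_simp
  have key := qLaguerre_qPV_aux (q := q) (A := A) (P := p * s) (δ := δ) (a2 := a2) (T := T) (y := y)
    hq hδ0 (by rw [hy, ht0]; ring) ha0 hTq
    (fun n => by
      have e := h1 n
      rw [ht, ht, hb, pow_succ] at e
      linear_combination e)
    (fun n => by
      have e := h2 (n + 1) (by omega)
      rw [ht, ht, hb, Nat.add_sub_cancel, pow_succ _ (n + 1)] at e
      linear_combination e)
    (by
      rw [ht, hb, pow_one] at h20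
      rw [hy 0, ht0]
      linear_combination h20)
    (fun n => by
      have e := h3 n
      have f := hrd n
      rw [ht, ht, hb, pow_succ] at e
      linear_combination e - (δ n - δ (n + 1)) * f)
  obtain ⟨k1, k2⟩ := key
  refine ⟨fun n => ?_, fun n hn => ?_⟩
  · apply mul_left_cancel₀ hA
    linear_combination k1 n - (q ^ n) ^ 2 * (y n * y (n + 1) - p * s * A) * eA
  · obtain ⟨m, rfl⟩ := Nat.exists_eq_succ_of_ne_zero (Nat.one_le_iff_ne_zero.mp hn)
    have k := k2 m
    simp only [Nat.succ_eq_add_one, Nat.add_sub_cancel]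
    apply mul_left_cancel₀ (pow_ne_zero 2 hA)
    have e : A * (q ^ (m + 1) * B * y (m + 1) + 1) = q ^ (m + 1) * y (m + 1) + A := by
      linear_combination q ^ (m + 1) * y (m + 1) * eA
    rw [← k, ← e]
    ring
end

section
/- Let 0<q<1, α ∈ ℝ, p ≥ 0, and let w(x) = x^α (−p/x²;q²)_∞ / ((−x²;q²)_∞ · (−q²/x²;q²)_∞) for x > 0. Then for every x > 0, w(x) / (p + x²) = w(x/q) / q^{2−α}. -/
/-- The defining recursion `(a;r)_∞ = (1 - a) (a r;r)_∞`. -/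
theorem qPoch_eq_one_sub_mul_s14 (a : ℝ) {r : ℝ} (hr0 : 0 ≤ r) (hr1 : r < 1) :
    qPoch a r = (1 - a) * qPoch (a * r) r := by
  have hs : Summable fun k : ℕ => -(a * r) * r ^ k :=
    (summable_geometric_of_lt_one hr0 hr1).mul_left _
  have hf (k : ℕ) : 1 - a * r ^ (k + 1) = 1 - a * r * r ^ k := by ring
  have hg (k : ℕ) : 1 + -(a * r) * r ^ k = 1 - a * r ^ (k + 1) := by ring
  have hm : Multipliable fun k : ℕ => 1 - a * r ^ (k + 1) := by
    simpa only [hg] using Real.multipliable_one_add_of_summable hs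
  have h := tprod_eq_zero_mul' (f := fun k : ℕ => 1 - a * r ^ k) hm
  simpa only [qPoch, hf, pow_zero, mul_one] using h

/-- Pearson-type relation for the semiclassical q-Laguerre weight:
`w(x)/(p+x²) = w(x/q)/q^{2-α}`. -/
theorem semiclassical_qLaguerre_pearson
    (q α p : ℝ) (hq0 : 0 < q) (hq1 : q < 1) (hp : 0 ≤ p)
    (w : ℝ → ℝ)
    (hw : ∀ x : ℝ, 0 < x →
      w x = x ^ α * qPoch (-(p / x ^ 2)) (q ^ 2)
        / (qPoch (-(x ^ 2)) (q ^ 2) * qPoch (-(q ^ 2) / x ^ 2) (q ^ 2)))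
    (x : ℝ) (hx : 0 < x) :
    w x / (p + x ^ 2) = w (x / q) / q ^ (2 - α) := by
  have hr0 : 0 ≤ q ^ 2 := by positivity
  have hr1 : q ^ 2 < 1 := pow_lt_one₀ hq0.le hq1 two_ne_zero
  have hP := qPoch_eq_one_sub_mul_s14 (-(p / x ^ 2)) hr0 hr1
  have hB := qPoch_eq_one_sub_mul_s14 (-((x / q) ^ 2)) hr0 hr1
  have hC := qPoch_eq_one_sub_mul_s14 (-(q ^ 2) / x ^ 2) hr0 hr1
  have eP : -(p / x ^ 2) * q ^ 2 = -(p / (x / q) ^ 2) := by field_simp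
  have eB : -((x / q) ^ 2) * q ^ 2 = -(x ^ 2) := by field_simp
  have eC : -(q ^ 2) / x ^ 2 * q ^ 2 = -(q ^ 2) / (x / q) ^ 2 := by field_simp
  rw [eP] at hP
  rw [eB] at hB
  rw [eC] at hC
  rw [hw x hx, hw (x / q) (by positivity), hP, hB, hC, Real.div_rpow hx.le hq0.le,
    Real.rpow_sub hq0, Real.rpow_two]
  generalize qPoch (-(p / (x / q) ^ 2)) (q ^ 2) = P
  generalize qPoch (-(x ^ 2)) (q ^ 2) = B
  generalize qPoch (-(q ^ 2) / (x / q) ^ 2) (q ^ 2) = C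
  have hqα : q ^ α ≠ 0 := (Real.rpow_pos_of_pos hq0 α).ne'
  have h1 : (1 - -(p / x ^ 2)) = (p + x ^ 2) / x ^ 2 := by field_simp; ring
  have h2 : (1 - -((x / q) ^ 2)) = (x ^ 2 + q ^ 2) / q ^ 2 := by field_simp; ring
  have h3 : (1 - -(q ^ 2) / x ^ 2) = (x ^ 2 + q ^ 2) / x ^ 2 := by field_simp; ring
  have hpx : p + x ^ 2 ≠ 0 := by positivity
  have hxq : x ^ 2 + q ^ 2 ≠ 0 := by positivity
  rw [h1, h2, h3]
  field_simp
end

section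
/- Let 0<q<1, α ∈ ℝ, and let real sequences (δ_n)_{n≥0}, (b_n)_{n≥0}, (a_n²)_{n≥0}, (t_n)_{n≥0}, (T_n)_{n≥0}, (r_n)_{n≥0} satisfy δ_0 = t_0 = r_0 = 0, a_0² = 0, T_n = q^{n−1}(δ_n − q δ_{n+1}), r_n = q^{n−1}(1−q) δ_n, b_n = δ_n − δ_{n+1} for all n ≥ 0, and the compatibility equations: (i) t_{n+1} + t_n = −b_n T_n + q^{−α} for n ≥ 0; (ii) −b_n t_{n+1} + b_n t_n = a_{n+1}² T_{n+1} − a_n² T_{n−1} for n ≥ 1, together with −b_0 t_1 = a_1² T_1; (iii) t_{n+1} − q t_n − b_n r_{n+1} + b_n r_n = a_{n+1}² q^{n+1} − a_n² q^{n−1} for n ≥ 0. Then for all n ≥ 0, a_n² q^{2n−1} = q^{−α}(1 − qⁿ) + qⁿ t_n, and for all n ≥ 1, a_n² T_n T_{n−1} = t_n (t_n − q^{−α}). -/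
/-- Ladder-operator compatibility relations for the semiclassical Stieltjes-Wigert
weight imply `a_n² q^{2n-1} = q^{-α}(1-qⁿ) + qⁿ t_n` and
`a_n² T_n T_{n-1} = t_n(t_n - q^{-α})`. -/
theorem stieltjes_wigert_ladder_consequences
    (q α : ℝ) (hq0 : 0 < q) (hq1 : q < 1)
    (δ b a2 t T r : ℕ → ℝ)
    (hδ0 : δ 0 = 0) (ht0 : t 0 = 0) (hr0 : r 0 = 0) (ha0 : a2 0 = 0)
    (hT : ∀ n : ℕ, T n = q ^ ((n : ℝ) - 1) * (δ n - q * δ (n + 1)))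
    (hr : ∀ n : ℕ, r n = q ^ ((n : ℝ) - 1) * (1 - q) * δ n)
    (hb : ∀ n : ℕ, b n = δ n - δ (n + 1))
    (h1 : ∀ n : ℕ, t (n + 1) + t n = -(b n) * T n + q ^ (-α))
    (h2 : ∀ n : ℕ, 1 ≤ n →
      -(b n) * t (n + 1) + b n * t n = a2 (n + 1) * T (n + 1) - a2 n * T (n - 1))
    (h20 : -(b 0) * t 1 = a2 1 * T 1)
    (h3 : ∀ n : ℕ,
      t (n + 1) - q * t n - b n * r (n + 1) + b n * r n
        = a2 (n + 1) * q ^ ((n : ℝ) + 1) - a2 n * q ^ ((n : ℝ) - 1)) :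
    (∀ n : ℕ, a2 n * q ^ (2 * (n : ℝ) - 1) = q ^ (-α) * (1 - q ^ (n : ℝ)) + q ^ (n : ℝ) * t n) ∧
    (∀ n : ℕ, 1 ≤ n → a2 n * T n * T (n - 1) = t n * (t n - q ^ (-α))) := by
  have hpred (n : ℕ) : q ^ ((n : ℝ) - 1) = q ^ n / q := by
    rw [Real.rpow_sub_one hq0.ne', Real.rpow_natCast]
  have hsucc (n : ℕ) : q ^ ((n : ℝ) + 1) = q ^ n * q := by
    rw [Real.rpow_add_one hq0.ne', Real.rpow_natCast]
  have hdouble (n : ℕ) : q ^ (2 * (n : ℝ) - 1) = (q ^ n) ^ 2 / q := by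
    rw [Real.rpow_sub_one hq0.ne', mul_comm, Real.rpow_mul hq0.le, Real.rpow_natCast,
      Real.rpow_ofNat]
  simp only [hpred, hsucc, hdouble, Real.rpow_natCast] at *
  generalize q ^ (-α) = c at *
  have hrT (n : ℕ) : r (n + 1) - r n = -(1 - q) * T n := by
    rw [hr, hr, hT]
    field_simp
    ring
  refine ⟨fun n => ?_, fun n hn => ?_⟩
  · induction n with
    | zero => simp [ha0, ht0]
    | succ n ih =>
      have hstep : q * t (n + 1) - t n + (1 - q) * c
          = a2 (n + 1) * (q ^ n * q) - a2 n * (q ^ n / q) := by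
        linear_combination h3 n + b n * hrT n - (1 - q) * h1 n
      have hpow : (q ^ (n + 1)) ^ 2 / q = q ^ n * (q ^ n * q) := by
        field_simp
        ring
      rw [hpow, pow_succ]
      linear_combination ih - q ^ n * hstep
  · induction n, hn using Nat.le_induction with
    | base =>
      have h10 := h1 0
      simp only [Nat.sub_self, zero_add, ht0] at h10 ⊢
      linear_combination -T 0 * h20 - t 1 * h10
    | succ n hn ih =>
      rw [Nat.add_sub_cancel]
      linear_combination ih - T n * h2 n hn - (t (n + 1) - t n) * h1 n
end

section
/- Let 0<q<1, α ∈ ℝ, and let real sequences (δ_n)_{n≥0}, (b_n)_{n≥0}, (a_n²)_{n≥0}, (t_n)_{n≥0}, (T_n)_{n≥0}, (r_n)_{n≥0} satisfy δ_0 = t_0 = r_0 = 0, a_0² = 0, T_n = q^{n−1}(δ_n − q δ_{n+1}), r_n = q^{n−1}(1−q) δ_n, b_n = δ_n − δ_{n+1} for all n ≥ 0, and the compatibility equations: (i) t_{n+1} + t_n = −b_n T_n + q^{−α} for n ≥ 0; (ii) −b_n t_{n+1} + b_n t_n = a_{n+1}² T_{n+1} − a_n² T_{n−1} for n ≥ 1,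 together with −b_0 t_1 = a_1² T_1; (iii) t_{n+1} − q t_n − b_n r_{n+1} + b_n r_n = a_{n+1}² q^{n+1} − a_n² q^{n−1} for n ≥ 0. Then for all n ≥ 1, T_n² = q^{2n+α} (t_n − q^{−α})(t_{n+1} − q^{−α}), and the identity q^{2α} (q^{−α}(1 − qⁿ) + qⁿ t_n)² (t_{n+1} − q^{−α})(t_{n−1} − q^{−α})(t_n − q^{−α})² = t_n² (t_n − q^{−α})² holds; consequently, if t_n ≠ q^{−α} for n ≥ 1, then x_n := t_n − q^{−α} satisfies the q-discrete Painlevé III equation in the multiplied form x_{n−1} x_{n+1} (q^{n+α} x_n + 1)² = (x_n + q^{−α})². -/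
/-- One step of the recursion for `T_n²` when the previous `T` does not vanish. -/
lemma sq_step_of_ne_zero {q c Q T₀ T₁ b₀ b₁ x₀ x₁ x₂ : ℝ}
    (hT₀ : T₀ ≠ 0)
    (hR : T₁ - q * Q * b₁ = q * T₀ - Q * b₀)
    (h₀ : b₀ * T₀ = -(c + x₀ + x₁)) (h₁ : b₁ * T₁ = -(c + x₁ + x₂))
    (hP : (c + q * Q * x₁) * (T₁ * T₀) = q * Q ^ 2 * x₁ * (x₁ + c))
    (hV : c * T₀ ^ 2 = Q ^ 2 * x₀ * x₁) :
    c * T₁ ^ 2 = (q * Q) ^ 2 * x₁ * x₂ := by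
  refine mul_left_cancel₀ (pow_ne_zero 2 hT₀) ?_
  linear_combination -(q * Q * x₁ * T₀ ^ 2 * T₁) * hR - q ^ 2 * Q ^ 2 * x₁ * T₀ ^ 2 * h₁
    + q * Q ^ 2 * x₁ * T₀ * T₁ * h₀ + q * T₀ * T₁ * hV - q * T₀ ^ 2 * hP + T₀ * T₁ * hP

/-- The squares of the `T_n`, from the compatibility relations in telescoped form. -/
lemma sq_of_recurrences {q c : ℝ} (hq : q ≠ 0) (hc : c ≠ 0) {T b x a : ℕ → ℝ}
    (hx0 : x 0 = -c) (hb0 : b 0 = T 0)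
    (hR : ∀ n, T (n + 1) - q * q ^ n * b (n + 1) = q * T n - q ^ n * b n)
    (hb : ∀ n, b n * T n = -(c + x n + x (n + 1)))
    (ha : ∀ n, a (n + 1) * (q * (q ^ n) ^ 2) = c + q * q ^ n * x (n + 1))
    (h0 : -(b 0) * (x 1 - x 0) = a 1 * T 1)
    (h2 : ∀ n, -(b (n + 1)) * (x (n + 2) - x (n + 1)) = a (n + 2) * T (n + 2) - a (n + 1) * T n)
    (hP : ∀ n, (c + q * q ^ n * x (n + 1)) * (T (n + 1) * T n)
      = q * (q ^ n) ^ 2 * x (n + 1) * (x (n + 1) + c)) (n : ℕ) :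
    c * T n ^ 2 = (q ^ n) ^ 2 * x n * x (n + 1) := by
  induction n using Nat.strong_induction_on with
  | _ n ih =>
  rcases n with _ | n
  · have := hb 0
    rw [hb0, hx0] at this
    rw [hx0]
    linear_combination c * this
  have hVn := ih n (by omega)
  rw [pow_succ' q n]
  by_cases hT : T n = 0
  swap
  · exact sq_step_of_ne_zero hT (hR n) (hb n) (hb (n + 1)) (hP n) hVn
  have hsum : c + x n + x (n + 1) = 0 := by
    have := hb n
    rw [hT] at this
    linarith
  have hprod : x n * x (n + 1) = 0 := by
    have : (q ^ n) ^ 2 * (x n * x (n + 1)) = 0 := by rw [← mul_assoc, ← hVn, hT]; ring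
    simpa [hq] using this
  have T_eq_zero (k : ℕ) (hk : k < n + 1) (h : x (k + 1) = 0) : T k = 0 := by
    have := ih k hk
    rw [h, mul_zero] at this
    simpa [hc] using this
  rcases n with _ | m
  · have hx1 : x 1 = 0 := by simpa [hx0] using hsum
    have a0 := ha 0
    simp only [hb0, hT, hx1, zero_add, pow_zero, mul_zero, add_zero, neg_zero, zero_mul] at h0 a0 ⊢
    have ha1 : a 1 ≠ 0 := by
      intro h
      rw [h, zero_mul] at a0
      exact hc a0.symm
    have hT1 : T 1 = 0 := by simpa [ha1] using h0.symm
    rw [hT1]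
    ring
  have r := hR m
  have e := h2 m
  have A₂ := ha (m + 1)
  rw [pow_succ'] at A₂
  rcases mul_eq_zero.mp hprod with hx | hx
  · have hx' : x (m + 2) = -c := by linear_combination hsum - hx
    have hTm := T_eq_zero m (by omega) hx
    have r' := hR (m + 1)
    have hb2 := hb (m + 2)
    rw [pow_succ'] at r' ⊢
    simp only [add_assoc, Nat.reduceAdd] at *
    rw [hx'] at A₂ e hb2 ⊢
    rw [hx, hTm] at e
    rw [hT] at r'
    have key : T (m + 2) = (q * (q * q ^ m)) ^ 2 * b (m + 2) := by
      refine mul_left_cancel₀ hc ?_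
      linear_combination c * (q * (q * q ^ m)) * r' - T (m + 2) * A₂
        - (q * (q * q ^ m) ^ 2) * e
    linear_combination c * T (m + 2) * key + c * (q * (q * q ^ m)) ^ 2 * hb2
  · have hx' : x (m + 1) = -c := by linear_combination hsum - hx
    have A₁ := ha m
    have hbm := hb m
    have hVm := ih m (by omega)
    simp only [add_assoc, Nat.reduceAdd] at *
    have key : T m = (q ^ m) ^ 2 * b m := by
      by_cases hTm : T m = 0
      · have hxm : x m = 0 := by
          rw [hTm, hx'] at hbm
          linear_combination hbm
        rcases m with _ | k
        · exact absurd hxm (by simpa [hx0] using hc)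
        have hTk := T_eq_zero k (by omega) hxm
        have e' := h2 k
        simp only [add_assoc, Nat.reduceAdd] at *
        rw [hT, hTk, hxm, hx'] at e'
        have : b (k + 1) = 0 := by
          refine mul_left_cancel₀ hc ?_
          linear_combination e'
        rw [this, hTm, mul_zero]
      · refine mul_left_cancel₀ (mul_ne_zero hc hTm) ?_
        rw [hx'] at hVm hbm
        linear_combination hVm - c * (q ^ m) ^ 2 * hbm
    have hT2 : T (m + 2) = 0 := by
      rw [hx] at A₂ e
      rw [hx'] at A₁ e
      rw [hT] at r
      refine mul_left_cancel₀ hc ?_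
      linear_combination -T (m + 2) * A₂ - (q * (q * q ^ m) ^ 2) * e + q ^ 2 * T m * A₁
        + q ^ 2 * q ^ m * c * r + q ^ 2 * c * key
    rw [hT2, hx]
    ring

/-- Ladder-operator compatibility relations for the semiclassical Stieltjes-Wigert
weight imply `T_n² = q^{2n+α}(t_n - q^{-α})(t_{n+1} - q^{-α})` and that
`x_n := t_n - q^{-α}` satisfies q-Painlevé III in multiplied form. -/
theorem stieltjes_wigert_ladder_qPIII
    (q α : ℝ) (hq0 : 0 < q) (hq1 : q < 1)
    (δ b a2 t T r : ℕ → ℝ)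
    (hδ0 : δ 0 = 0) (ht0 : t 0 = 0) (hr0 : r 0 = 0) (ha0 : a2 0 = 0)
    (hT : ∀ n : ℕ, T n = q ^ ((n : ℝ) - 1) * (δ n - q * δ (n + 1)))
    (hr : ∀ n : ℕ, r n = q ^ ((n : ℝ) - 1) * (1 - q) * δ n)
    (hb : ∀ n : ℕ, b n = δ n - δ (n + 1))
    (h1 : ∀ n : ℕ, t (n + 1) + t n = -(b n) * T n + q ^ (-α))
    (h2 : ∀ n : ℕ, 1 ≤ n →
      -(b n) * t (n + 1) + b n * t n = a2 (n + 1) * T (n + 1) - a2 n * T (n - 1))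
    (h20 : -(b 0) * t 1 = a2 1 * T 1)
    (h3 : ∀ n : ℕ,
      t (n + 1) - q * t n - b n * r (n + 1) + b n * r n
        = a2 (n + 1) * q ^ ((n : ℝ) + 1) - a2 n * q ^ ((n : ℝ) - 1)) :
    (∀ n : ℕ, 1 ≤ n →
      T n ^ 2 = q ^ (2 * (n : ℝ) + α) * (t n - q ^ (-α)) * (t (n + 1) - q ^ (-α))) ∧
    (∀ n : ℕ, 1 ≤ n →
      q ^ (2 * α) * (q ^ (-α) * (1 - q ^ (n : ℝ)) + q ^ (n : ℝ) * t n) ^ 2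
          * (t (n + 1) - q ^ (-α)) * (t (n - 1) - q ^ (-α)) * (t n - q ^ (-α)) ^ 2
        = t n ^ 2 * (t n - q ^ (-α)) ^ 2) ∧
    ((∀ n : ℕ, 1 ≤ n → t n ≠ q ^ (-α)) →
      ∀ x : ℕ → ℝ, (∀ n : ℕ, x n = t n - q ^ (-α)) →
        ∀ n : ℕ, 1 ≤ n →
          x (n - 1) * x (n + 1) * (q ^ ((n : ℝ) + α) * x n + 1) ^ 2
            = (x n + q ^ (-α)) ^ 2) := by
  obtain ⟨c, hc⟩ : ∃ c, c = q ^ (-α) := ⟨_, rfl⟩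
  have hcpos : 0 < c := hc ▸ Real.rpow_pos_of_pos hq0 _
  have hq : q ≠ 0 := hq0.ne'
  have hc0 : c ≠ 0 := hcpos.ne'
  have hα : q ^ α = c⁻¹ := by rw [hc, Real.rpow_neg hq0.le, inv_inv]
  have e1 (n : ℕ) : q ^ ((n : ℝ) - 1) = q ^ n / q := by
    rw [Real.rpow_sub_one hq, Real.rpow_natCast]
  have e2 (n : ℕ) : q ^ ((n : ℝ) + 1) = q ^ n * q := by
    rw [Real.rpow_add_one hq, Real.rpow_natCast]
  have e3 (n : ℕ) : q ^ (2 * (n : ℝ) + α) = (q ^ n) ^ 2 * c⁻¹ := by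
    rw [Real.rpow_add hq0, hα, mul_comm 2 (n : ℝ), Real.rpow_mul hq0.le, Real.rpow_natCast,
      Real.rpow_ofNat]
  have e4 : q ^ (2 * α) = c⁻¹ ^ 2 := by
    rw [mul_comm, Real.rpow_mul hq0.le, hα, Real.rpow_ofNat]
  have e5 (n : ℕ) : q ^ ((n : ℝ) + α) = q ^ n * c⁻¹ := by
    rw [Real.rpow_add hq0, hα, Real.rpow_natCast]
  simp only [e1, e2, e3, e4, e5, ← hc, Real.rpow_natCast] at *
  have hT' (n : ℕ) : q * T n = q ^ n * (δ n - q * δ (n + 1)) := by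
    rw [hT]; field_simp
  have hbT (n : ℕ) : b n * T n = c - t n - t (n + 1) := by linear_combination h1 n
  have ha (n : ℕ) : a2 n * (q ^ n) ^ 2 = q * (c * (1 - q ^ n) + q ^ n * t n) := by
    induction n with
    | zero => simp [ha0, ht0]
    | succ n ih =>
      have hrr : r (n + 1) - r n = -(1 - q) * T n := by
        rw [hr, hr, hT, pow_succ]; field_simp; ring
      have h := h3 n
      field_simp at h
      rw [pow_succ]
      linear_combination -q ^ n * h + ih - q * q ^ n * b n * hrr + q * q ^ n * (1 - q) * hbT n
  have hTT (n : ℕ) : a2 (n + 1) * (T (n + 1) * T n) = t (n + 1) * (t (n + 1) - c) := by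
    induction n with
    | zero =>
      have := hbT 0
      rw [ht0] at this
      simp only [zero_add]
      linear_combination -T 0 * h20 - t 1 * this
    | succ n ih =>
      have h := h2 (n + 1) (by omega)
      simp only [Nat.add_sub_cancel] at h
      linear_combination -T (n + 1) * h + ih - (t (n + 2) - t (n + 1)) * hbT (n + 1)
  have ha' (n : ℕ) :
      a2 (n + 1) * (q * (q ^ n) ^ 2) = c + q * q ^ n * (t (n + 1) - c) := by
    refine mul_left_cancel₀ hq ?_
    have := ha (n + 1)
    rw [pow_succ] at this
    linear_combination this
  have hP (n : ℕ) : (c + q * q ^ n * (t (n + 1) - c)) * (T (n + 1) * T n)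
      = q * (q ^ n) ^ 2 * (t (n + 1) - c) * (t (n + 1) - c + c) := by
    linear_combination -(T (n + 1) * T n) * ha' n + q * (q ^ n) ^ 2 * hTT n
  have hV (n : ℕ) : c * T n ^ 2 = (q ^ n) ^ 2 * (t n - c) * (t (n + 1) - c) := by
    refine sq_of_recurrences (x := fun n ↦ t n - c) (b := b) (a := a2) hq hc0 ?_ ?_ ?_ ?_ ha' ?_ ?_
      hP n
    · simp [ht0]
    · refine mul_left_cancel₀ hq ?_
      rw [hT', hb, hδ0]; ring
    · intro n
      refine mul_left_cancel₀ hq ?_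
      have T₁ := hT' (n + 1)
      rw [pow_succ] at T₁
      rw [hb, hb]
      linear_combination T₁ - q * hT' n
    · intro n
      rw [hbT]; ring
    · rw [← h20, ht0]; ring
    · intro n
      have h := h2 (n + 1) (by omega)
      simp only [Nat.add_sub_cancel] at h
      linear_combination h
  have hx (n : ℕ) : (c * (1 - q ^ (n + 1)) + q ^ (n + 1) * t (n + 1)) ^ 2
      * (t (n + 2) - c) * (t n - c) * (t (n + 1) - c) ^ 2
      = c ^ 2 * (t (n + 1) ^ 2 * (t (n + 1) - c) ^ 2) := by
    refine mul_left_cancel₀ (pow_ne_zero 2 (mul_ne_zero hq (pow_ne_zero 2 (pow_ne_zero n hq)))) ?_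
    have V₁ := hV (n + 1)
    have V₀ := hV n
    have hP2 := congrArg (· ^ 2) (hP n)
    rw [pow_succ] at V₁ ⊢
    linear_combination c ^ 2 * hP2
      - (c + q * q ^ n * (t (n + 1) - c)) ^ 2 * c * T n ^ 2 * V₁
      - (c + q * q ^ n * (t (n + 1) - c)) ^ 2 * ((q ^ n * q) ^ 2 * (t (n + 1) - c)
        * (t (n + 2) - c)) * V₀
  refine ⟨fun n _ ↦ ?_, fun n hn ↦ ?_, fun hne x hxt n hn ↦ ?_⟩
  · refine mul_left_cancel₀ hc0 ?_
    rw [hV]; field_simp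
  · obtain ⟨n, rfl⟩ := Nat.exists_eq_add_of_le' hn
    have := hx n
    simp only [Nat.add_sub_cancel]
    field_simp
    linear_combination this
  · have hne := sub_ne_zero.mpr (hne n hn)
    obtain ⟨n, rfl⟩ := Nat.exists_eq_add_of_le' hn
    have := hx n
    simp only [Nat.add_sub_cancel, hxt]
    refine mul_left_cancel₀ (pow_ne_zero 2 hne) ?_
    clear hne
    field_simp
    linear_combination this
end

section
/- Let 0<q<1, α ∈ ℝ, p ≥ 0, and let real sequences (δ_n)_{n≥0}, (b_n)_{n≥0}, (a_n²)_{n≥0}, (t_n)_{n≥0}, (T_n)_{n≥0}, (r_n)_{n≥0} satisfy δ_0 = t_0 = r_0 = 0, a_0² = 0, T_n = q^{n−1}(δ_n − q δ_{n+1}), r_n = q^{n−1}(1−q) δ_n, b_n = δ_n − δ_{n+1} for all n ≥ 0, and the compatibility equations: (i) t_{n+1} + t_n + p q^{−2}(−1 + qⁿ + q^{n+1}) = −b_n T_n + q^{−α} for n ≥ 0; (ii) −b_n(t_{n+1} − t_n) + b_n qⁿ (1−q) p q^{−2} = a_{n+1}² T_{n+1} − a_n² T_{n−1} for n ≥ 1,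 together with −b_0 t_1 + b_0 (1−q) p q^{−2} = a_1² T_1; (iii) t_{n+1} − q t_n − b_n r_{n+1} + b_n r_n = a_{n+1}² q^{n+1} − a_n² q^{n−1} for n ≥ 0. Then for all n ≥ 0, a_n² q^{2n−1} = (q^{−α} + p q^{−2})(1 − qⁿ) − p q^{−2}(1 − q^{2n}) + qⁿ t_n, and for all n ≥ 1, a_n² T_n T_{n−1} = t_n (t_n − q^{−α} − p q^{−2} + 2 p q^{n−2}) + p q^{−2}(q^{−α} + p q^{−2})(1 − qⁿ) − p² q^{−4}(1 − q^{2n}). -/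
/-- Ladder-operator compatibility relations for the semiclassical q-Laguerre weight
imply the expressions for `a_n² q^{2n-1}` and `a_n² T_n T_{n-1}` in terms of `t_n`. -/
theorem qLaguerre_ladder_consequences
    (q α p : ℝ) (hq0 : 0 < q) (hq1 : q < 1) (hp : 0 ≤ p)
    (δ b a2 t T r : ℕ → ℝ)
    (hδ0 : δ 0 = 0) (ht0 : t 0 = 0) (hr0 : r 0 = 0) (ha0 : a2 0 = 0)
    (hT : ∀ n : ℕ, T n = q ^ ((n : ℝ) - 1) * (δ n - q * δ (n + 1)))
    (hr : ∀ n : ℕ, r n = q ^ ((n : ℝ) - 1) * (1 - q) * δ n)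
    (hb : ∀ n : ℕ, b n = δ n - δ (n + 1))
    (h1 : ∀ n : ℕ,
      t (n + 1) + t n + p * q ^ (-2 : ℝ) * (-1 + q ^ (n : ℝ) + q ^ ((n : ℝ) + 1))
        = -(b n) * T n + q ^ (-α))
    (h2 : ∀ n : ℕ, 1 ≤ n →
      -(b n) * (t (n + 1) - t n) + b n * q ^ (n : ℝ) * (1 - q) * p * q ^ (-2 : ℝ)
        = a2 (n + 1) * T (n + 1) - a2 n * T (n - 1))
    (h20 : -(b 0) * t 1 + b 0 * (1 - q) * p * q ^ (-2 : ℝ) = a2 1 * T 1)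
    (h3 : ∀ n : ℕ,
      t (n + 1) - q * t n - b n * r (n + 1) + b n * r n
        = a2 (n + 1) * q ^ ((n : ℝ) + 1) - a2 n * q ^ ((n : ℝ) - 1)) :
    (∀ n : ℕ,
      a2 n * q ^ (2 * (n : ℝ) - 1)
        = (q ^ (-α) + p * q ^ (-2 : ℝ)) * (1 - q ^ (n : ℝ))
          - p * q ^ (-2 : ℝ) * (1 - q ^ (2 * (n : ℝ))) + q ^ (n : ℝ) * t n) ∧
    (∀ n : ℕ, 1 ≤ n →
      a2 n * T n * T (n - 1)
        = t n * (t n - q ^ (-α) - p * q ^ (-2 : ℝ) + 2 * p * q ^ ((n : ℝ) - 2))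
          + p * q ^ (-2 : ℝ) * (q ^ (-α) + p * q ^ (-2 : ℝ)) * (1 - q ^ (n : ℝ))
          - p ^ 2 * q ^ (-4 : ℝ) * (1 - q ^ (2 * (n : ℝ)))) := by
  have hq : q ≠ 0 := hq0.ne'
  have e1 (n : ℕ) : q ^ ((n : ℝ) - 1) = q ^ n / q := by
    rw [Real.rpow_sub hq0, Real.rpow_natCast, Real.rpow_one]
  have e2 (n : ℕ) : q ^ ((n : ℝ) - 2) = q ^ n * q ^ (-2 : ℝ) := by
    rw [sub_eq_add_neg, Real.rpow_add hq0, Real.rpow_natCast]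
  have e3 (n : ℕ) : q ^ ((n : ℝ) + 1) = q ^ n * q := by
    rw [Real.rpow_add hq0, Real.rpow_natCast, Real.rpow_one]
  have e4 (n : ℕ) : q ^ (2 * (n : ℝ)) = (q ^ n) ^ 2 := by
    rw [two_mul, Real.rpow_add hq0, Real.rpow_natCast, sq]
  have e5 (n : ℕ) : q ^ (2 * (n : ℝ) - 1) = (q ^ n) ^ 2 / q := by
    rw [Real.rpow_sub hq0, e4, Real.rpow_one]
  have e6 : q ^ (-4 : ℝ) = (q ^ (-2 : ℝ)) ^ 2 := by
    rw [sq, ← Real.rpow_add hq0]; norm_num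
  simp only [e1, e2, e3, e4, e5, e6, Real.rpow_natCast] at hT hr h1 h2 h3 ⊢
  clear e1 e2 e3 e4 e5 e6
  generalize q ^ (-2 : ℝ) = c at *
  generalize q ^ (-α) = A at *
  have hbr (n : ℕ) : b n * r (n + 1) - b n * r n = -(1 - q) * (b n * T n) := by
    rw [hr, hr, hT, pow_succ]
    field_simp
    ring
  constructor
  · intro n
    induction n with
    | zero => simp [ha0, ht0]
    | succ n ih =>
      have h : a2 (n + 1) * (q ^ n * q) - a2 n * (q ^ n / q)
          = q * t (n + 1) - t n + (1 - q) * (A + p * c) - p * c * q ^ n * (1 - q ^ 2) := by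
        linear_combination -h3 n - hbr n + (1 - q) * h1 n
      have hs : (q ^ (n + 1)) ^ 2 / q = (q ^ n) ^ 2 * q := by
        field_simp; ring
      rw [hs, pow_succ]
      linear_combination q ^ n * h + ih
  · have step (n : ℕ) : -(b n) * (t (n + 1) - t n) + b n * q ^ n * (1 - q) * p * c
        = a2 (n + 1) * T (n + 1) - a2 n * T (n - 1) := by
      rcases Nat.eq_zero_or_pos n with rfl | hn
      · simpa [ht0, ha0] using h20
      · exact h2 n hn
    intro n _
    induction n with
    | zero => simp [ha0, ht0]
    | succ n ih =>
      have ih' : a2 n * T n * T (n - 1)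
          = t n * (t n - A - p * c + 2 * p * (q ^ n * c))
            + p * c * (A + p * c) * (1 - q ^ n) - p ^ 2 * c ^ 2 * (1 - (q ^ n) ^ 2) := by
        rcases Nat.eq_zero_or_pos n with rfl | hn
        · simp [ha0, ht0]
        · exact ih hn
      rw [Nat.add_sub_cancel, pow_succ]
      linear_combination
        ih' - T n * step n + (t n - t (n + 1) + p * c * q ^ n * (1 - q)) * h1 n
end

section
/- Let 0<q<1, α ∈ ℝ, and let real sequences (r_n)_{n≥0}, (R_n)_{n≥0}, (b_n)_{n≥0}, (a_n²)_{n≥0} satisfy r_0 = 0, a_0² = 0, and the compatibility equations: (i) r_{n+1} + r_n = −b_n R_n − (1 − q^{−α}) for n ≥ 0; (ii) b_n q^{−n−α+1} = R_n + (q−1) ∑_{j=0}^{n} R_j for n ≥ 0; (iii) a_{n+1}² R_{n+1} − a_n² R_{n−1} = −b_n (r_{n+1} − r_n) for n ≥ 1, together with a_1² R_1 = −b_0 r_1; (iv) q^{−n−α} a_{n+1}² − q^{−n−α+2} a_n² = r_{n+1} − q r_n + 1 − q for n ≥ 0. Then: (a) a_n² = q^{n+α−1} (r_n + 1 − qⁿ)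 for all n ≥ 0; (b) a_n² R_n R_{n−1} = r_n (r_n + 1 − q^{−α}) for all n ≥ 1; (c) R_n² = −q^{−2n−α} ((r_n + 1)(r_{n+1} + 1) − q^{−α}) for all n ≥ 1; and (d) the sequence x_n := q^{α/2} (r_n + 1) satisfies, for all n ≥ 1, the q-discrete Painlevé V equation in the multiplied form (x_n x_{n−1} − 1)(x_n x_{n+1} − 1)(x_n − q^{n+α/2})² = q^{2n+α} (x_n − q^{α/2})² (x_n − q^{−α/2})². -/
/-- The pair of relations, linear in `b` and `R`, that integrates the compatibility equations;
here `p = q ^ (-α)`. -/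
theorem ladder_linear_relations {q p : ℝ} (hq : q ≠ 0) {r R b a2 : ℕ → ℝ}
    (ha : ∀ n, p * q * a2 n = q ^ n * (r n + 1 - q ^ n))
    (hb0 : p * b 0 = R 0)
    (hb : ∀ n, p * b (n + 1) - q ^ (n + 1) * R (n + 1) = p * q * b n - q ^ n * R n)
    (h3 : ∀ n, a2 (n + 2) * R (n + 2) - a2 (n + 1) * R n = -(b (n + 1)) * (r (n + 2) - r (n + 1)))
    (h30 : a2 1 * R 1 = -(b 0) * r 1) (n : ℕ) :
    p * (r (n + 1) + 1) * b n - (q ^ n) ^ 2 * R n + p * a2 (n + 1) * R (n + 1) = 0 ∧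
    p * (r (n + 1) + 1) * b (n + 1) - (q ^ (n + 1)) ^ 2 * R (n + 1) + p * a2 (n + 1) * R n = 0 := by
  have step : ∀ n, p * (r (n + 1) + 1) * b n - (q ^ n) ^ 2 * R n
        + p * a2 (n + 1) * R (n + 1) = 0 →
      p * (r (n + 1) + 1) * b (n + 1) - (q ^ (n + 1)) ^ 2 * R (n + 1)
        + p * a2 (n + 1) * R n = 0 := by
    intro n h
    have hn : p * a2 (n + 1) = q ^ n * (r (n + 1) + 1 - q ^ (n + 1)) := by
      apply mul_left_cancel₀ hq
      linear_combination ha (n + 1)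
    rw [hn] at h ⊢
    linear_combination q * h + (r (n + 1) + 1) * hb n
  induction n with
  | zero =>
    have h : p * (r (0 + 1) + 1) * b 0 - (q ^ 0) ^ 2 * R 0 + p * a2 (0 + 1) * R (0 + 1) = 0 := by
      linear_combination hb0 + p * h30
    exact ⟨h, step 0 h⟩
  | succ n ih =>
    have h : p * (r (n + 1 + 1) + 1) * b (n + 1) - (q ^ (n + 1)) ^ 2 * R (n + 1)
        + p * a2 (n + 1 + 1) * R (n + 1 + 1) = 0 := by
      linear_combination ih.2 + p * h3 n
    exact ⟨h, step (n + 1) h⟩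

/-- Ladder-operator compatibility relations on the exponential lattice for the
semiclassical little q-Laguerre weight imply the expressions for `a_n²`,
`a_n² R_n R_{n-1}`, `R_n²`, and that `x_n = q^{α/2}(r_n + 1)` satisfies q-Painlevé V
in multiplied form. -/
theorem little_qLaguerre_ladder_qPV
    (q α : ℝ) (hq0 : 0 < q) (hq1 : q < 1)
    (r R b a2 : ℕ → ℝ)
    (hr0 : r 0 = 0) (ha0 : a2 0 = 0)
    (h1 : ∀ n : ℕ, r (n + 1) + r n = -(b n) * R n - (1 - q ^ (-α)))
    (h2 : ∀ n : ℕ,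
      b n * q ^ (-(n : ℝ) - α + 1) = R n + (q - 1) * ∑ j ∈ Finset.range (n + 1), R j)
    (h3 : ∀ n : ℕ, 1 ≤ n →
      a2 (n + 1) * R (n + 1) - a2 n * R (n - 1) = -(b n) * (r (n + 1) - r n))
    (h30 : a2 1 * R 1 = -(b 0) * r 1)
    (h4 : ∀ n : ℕ,
      q ^ (-(n : ℝ) - α) * a2 (n + 1) - q ^ (-(n : ℝ) - α + 2) * a2 n
        = r (n + 1) - q * r n + 1 - q) :
    (∀ n : ℕ, a2 n = q ^ ((n : ℝ) + α - 1) * (r n + 1 - q ^ (n : ℝ))) ∧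
    (∀ n : ℕ, 1 ≤ n → a2 n * R n * R (n - 1) = r n * (r n + 1 - q ^ (-α))) ∧
    (∀ n : ℕ, 1 ≤ n →
      R n ^ 2 = -q ^ (-2 * (n : ℝ) - α) * ((r n + 1) * (r (n + 1) + 1) - q ^ (-α))) ∧
    (∀ x : ℕ → ℝ, (∀ n : ℕ, x n = q ^ (α / 2) * (r n + 1)) →
      ∀ n : ℕ, 1 ≤ n →
        (x n * x (n - 1) - 1) * (x n * x (n + 1) - 1) * (x n - q ^ ((n : ℝ) + α / 2)) ^ 2
          = q ^ (2 * (n : ℝ) + α) * (x n - q ^ (α / 2)) ^ 2 * (x n - q ^ (-(α / 2))) ^ 2) := by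
  have hq : q ≠ 0 := hq0.ne'
  have hk : q ^ (α / 2) ≠ 0 := (Real.rpow_pos_of_pos hq0 _).ne'
  have e0 : q ^ α = (q ^ (α / 2)) ^ 2 := by
    rw [← Real.rpow_natCast, ← Real.rpow_mul hq0.le]; congr 1; push_cast; ring
  have e1 : q ^ (-α) = ((q ^ (α / 2)) ^ 2)⁻¹ := by rw [Real.rpow_neg hq0.le, e0]
  have e2 : q ^ (-(α / 2)) = (q ^ (α / 2))⁻¹ := Real.rpow_neg hq0.le _
  have e3 (n : ℕ) : q ^ (-(n : ℝ) - α) = q ^ (-α) / q ^ n := by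
    rw [show -(n : ℝ) - α = -α - n by ring, Real.rpow_sub_natCast hq]
  have e4 (n : ℕ) : q ^ (-(n : ℝ) - α + 1) = q ^ (-α) * q / q ^ n := by
    rw [Real.rpow_add_one hq, e3]; ring
  have e5 (n : ℕ) : q ^ (-(n : ℝ) - α + 2) = q ^ (-α) * q ^ 2 / q ^ n := by
    rw [Real.rpow_add hq0, e3, Real.rpow_two]; ring
  have e6 (n : ℕ) : q ^ ((n : ℝ) + α - 1) = q ^ n / (q ^ (-α) * q) := by
    rw [Real.rpow_sub_one hq, Real.rpow_add hq0, Real.rpow_natCast, Real.rpow_neg hq0.le]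
    field_simp
  have e7 (n : ℕ) : q ^ (-2 * (n : ℝ) - α) = q ^ (-α) / (q ^ n) ^ 2 := by
    rw [show -2 * (n : ℝ) - α = -α - (n * 2 : ℕ) by push_cast; ring,
      Real.rpow_sub_natCast hq, pow_mul]
  have e8 (n : ℕ) : q ^ ((n : ℝ) + α / 2) = q ^ n * q ^ (α / 2) := by
    rw [Real.rpow_add hq0, Real.rpow_natCast]
  have e9 (n : ℕ) : q ^ (2 * (n : ℝ) + α) = (q ^ n) ^ 2 * (q ^ (α / 2)) ^ 2 := by
    rw [Real.rpow_add hq0, e0, show 2 * (n : ℝ) = (n * 2 : ℕ) by push_cast; ring,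
      Real.rpow_natCast, pow_mul]
  have hp : q ^ (-α) ≠ 0 := (Real.rpow_pos_of_pos hq0 _).ne'
  simp only [e3, e4, e5, e6, e7, e8, e9, e2, Real.rpow_natCast] at *
  have hpk : q ^ (-α) * (q ^ (α / 2)) ^ 2 = 1 := by rw [e1]; field_simp
  clear e0 e1 e2 e3 e4 e5 e6 e7 e8 e9
  generalize q ^ (-α) = p at *
  generalize q ^ (α / 2) = k at *
  have hqn (n : ℕ) : q ^ n ≠ 0 := pow_ne_zero n hq
  have ha (n : ℕ) : p * q * a2 n = q ^ n * (r n + 1 - q ^ n) := by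
    induction n with
    | zero => simp [ha0, hr0]
    | succ n ih =>
      have h := h4 n
      have hn := hqn n
      field_simp at h
      linear_combination q * h + q ^ 2 * ih
  have hb0 : p * b 0 = R 0 := by
    have h := h2 0
    simp only [pow_zero, div_one, zero_add, Finset.sum_range_one] at h
    apply mul_left_cancel₀ hq
    linear_combination h
  have hb (n : ℕ) :
      p * b (n + 1) - q ^ (n + 1) * R (n + 1) = p * q * b n - q ^ n * R n := by
    have h := h2 n
    have h' := h2 (n + 1)
    rw [Finset.sum_range_succ] at h'
    have hn := hqn n
    rw [pow_succ] at h'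
    field_simp at h h'
    linear_combination h' - h
  have hlin := ladder_linear_relations hq ha hb0 hb (fun n => h3 (n + 1) (by simp)) h30
  have hB (n : ℕ) : a2 (n + 1) * R (n + 1) * R n = r (n + 1) * (r (n + 1) + 1 - p) := by
    induction n with
    | zero =>
      have h := h1 0
      rw [hr0] at h
      linear_combination R 0 * h30 - r 1 * h
    | succ n ih =>
      have h := h3 (n + 1) (by simp)
      rw [Nat.add_sub_cancel] at h
      linear_combination ih + R (n + 1) * h - (r (n + 2) - r (n + 1)) * h1 (n + 1)
  have hC (n : ℕ) : (q ^ n) ^ 2 * R n ^ 2 = -p * ((r n + 1) * (r (n + 1) + 1) - p) := by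
    linear_combination (-R n) * (hlin n).1 + p * hB n + p * (r (n + 1) + 1) * h1 n
  refine ⟨fun n => ?_, fun n hn => ?_, fun n _ => ?_, fun x hx n hn => ?_⟩
  · field_simp
    linear_combination ha n
  · obtain ⟨m, rfl⟩ := Nat.exists_eq_add_of_le' hn
    exact hB m
  · have hn := hqn n
    field_simp
    linear_combination hC n
  · obtain ⟨m, rfl⟩ := Nat.exists_eq_add_of_le' hn
    rw [Nat.add_sub_cancel, hx, hx, hx]
    have hX (n : ℕ) : k * (r n + 1) * (k * (r (n + 1) + 1)) - 1
        = -k ^ 4 * (q ^ n) ^ 2 * R n ^ 2 := by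
      linear_combination k ^ 4 * hC n
        + (p * k ^ 2 + 1 - k ^ 2 * ((r n + 1) * (r (n + 1) + 1))) * hpk
    have hk' : k⁻¹ = k * p := by
      field_simp
      linear_combination -hpk
    have hP : q ^ (m + 1) * (r (m + 1) + 1 - q ^ (m + 1)) * (R (m + 1) * R m)
        = p * q * (r (m + 1) * (r (m + 1) + 1 - p)) := by
      linear_combination p * q * hB m - R (m + 1) * R m * ha (m + 1)
    rw [mul_comm (k * (r (m + 1) + 1)) (k * (r m + 1)), hX, hX, hk']
    linear_combination
      k ^ 10 * (q ^ m) ^ 2 * (q ^ (m + 1) * (r (m + 1) + 1 - q ^ (m + 1)) * (R (m + 1) * R m)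
        + p * q * (r (m + 1) * (r (m + 1) + 1 - p))) * hP
      + k ^ 6 * (q ^ (m + 1)) ^ 2 * (r (m + 1) * (r (m + 1) + 1 - p)) ^ 2 * (p * k ^ 2 + 1) * hpk
end
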